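/- arXiv:1105.1628 — 3 statements merged into one kernel-verified Lean document; each statement's English description precedes it below -/
import Mathlib

section
/- Let f : ℕ → ℂ be a multiplicative function with |f(n)| ≤ 1 for all n and with mean value M(f) = lim_{x→∞} (1/x) Σ_{n≤x} f(n) existing and nonzero. Then f belongs to B² if and only if both series S₁ = Σ_p (f(p) − 1)/p and S₂ = Σ_p |f(p) − 1|²/p (taken over primes p) converge. -/
open MeasureTheory Filter Finset
open scoped Classical

/-- `e t = exp(2πit)`. -/
noncomputable def e (t : ℝ) : ℂ := Complex.exp (2 * Real.pi * Complex.I * t)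

/-- `N` has (natural) density `ρ`. -/
def HasDensity (N : Set ℕ) (ρ : ℝ) : Prop :=
  Filter.Tendsto (fun x : ℕ => (((Finset.Icc 1 x).filter (fun n => n ∈ N)).card : ℝ) / x)
    Filter.atTop (nhds ρ)

/-- `N` has density `d` in the residue class `a` modulo `q`. -/
def HasResidueDensity (N : Set ℕ) (q a : ℕ) (d : ℝ) : Prop :=
  Filter.Tendsto (fun x : ℕ =>
      (((Finset.Icc 1 x).filter (fun n => n ∈ N ∧ n % q = a % q)).card : ℝ) / x)
    Filter.atTop (nhds d)

/-- `N` is distributed: all residue class densities exist. -/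
def Distributed (N : Set ℕ) : Prop := ∀ q, 1 ≤ q → ∀ a, ∃ d, HasResidueDensity N q a d

/-- The singular series `∑_{q≥1} ∑_{(a,q)=1} |∑_{b=1}^q (F(q,b)/ρ) e(ab/q)|²`. -/
noncomputable def extremalSum (F : ℕ → ℕ → ℝ) (ρ : ℝ) : ℝ :=
  ∑' q : ℕ, ∑ a ∈ (Finset.Icc 1 q).filter (fun a => Nat.Coprime a q),
    ‖∑ b ∈ Finset.Icc 1 q, ((F q b / ρ : ℝ) : ℂ) * e (((a : ℝ) * b) / q)‖ ^ 2

/-- `N` is extremal. -/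
def Extremal (N : Set ℕ) : Prop :=
  ∃ ρ : ℝ, 0 < ρ ∧ HasDensity N ρ ∧
    ∃ F : ℕ → ℕ → ℝ, (∀ q, 1 ≤ q → ∀ a, HasResidueDensity N q a (F q a)) ∧
      1 / ρ = extremalSum F ρ

/-- `S(θ) = ∑_{n ≤ x, n ∈ N} e(θn)`. -/
noncomputable def expSum (N : Set ℕ) (x : ℕ) (θ : ℝ) : ℂ :=
  ∑ n ∈ (Finset.Icc 1 x).filter (fun n => n ∈ N), e (θ * n)

/-- Rational major arcs `M(x,Q)`. -/
def majorArcs (x Q : ℕ) : Set ℝ :=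
  ⋃ q ∈ Finset.Icc 1 Q, ⋃ a ∈ (Finset.Icc 1 q).filter (fun a => Nat.Coprime a q),
    Set.Icc ((a : ℝ) / q - Q / x) ((a : ℝ) / q + Q / x)

/-- Rational minor arcs `m(x,Q) = [0,1] \ M(x,Q)`. -/
def minorArcs (x Q : ℕ) : Set ℝ := Set.Icc 0 1 \ majorArcs x Q

/-- Characteristic function of a set of naturals. -/
noncomputable def charFun (N : Set ℕ) : ℕ → ℂ := fun n => if n ∈ N then 1 else 0

/-- A (nonconstant-period) periodic function on `ℕ`. -/
def IsPeriodicFn (g : ℕ → ℂ) : Prop := ∃ p : ℕ, 1 ≤ p ∧ ∀ n, g (n + p) = g n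

/-- Trigonometric polynomials `n ↦ ∑ a_ν e(α_ν n)`. -/
def IsTrigPoly (g : ℕ → ℂ) : Prop :=
  ∃ (k : ℕ) (a : Fin k → ℂ) (α : Fin k → ℝ), ∀ n : ℕ, g n = ∑ ν : Fin k, a ν * e (α ν * n)

/-- The seminorm `‖f‖₂ = (limsup_x (1/x) ∑_{n≤x} |f n|²)^{1/2}`. -/
noncomputable def seminorm2 (f : ℕ → ℂ) : ℝ :=
  Real.sqrt (Filter.limsup (fun x : ℕ => (∑ n ∈ Finset.Icc 1 x, ‖f n‖ ^ 2) / x) Filter.atTop)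

/-- `f` lies in `A²`, the `‖·‖₂`-closure of the trigonometric polynomials. -/
def MemA2 (f : ℕ → ℂ) : Prop :=
  ∀ ε : ℝ, 0 < ε → ∃ g : ℕ → ℂ, IsTrigPoly g ∧ seminorm2 (fun n => f n - g n) < ε

/-- `f` lies in `B²`, the `‖·‖₂`-closure of the periodic functions. -/
def MemB2 (f : ℕ → ℂ) : Prop :=
  ∀ ε : ℝ, 0 < ε → ∃ g : ℕ → ℂ, IsPeriodicFn g ∧ seminorm2 (fun n => f n - g n) < ε

/-- `f` is `B²`-almost periodic: there is a sequence of periodic functions `fq` with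
`limsup_x (1/x) ∑_{n≤x} |f n - fq n|² → 0`. -/
def B2AlmostPeriodic (f : ℕ → ℂ) : Prop :=
  ∃ fq : ℕ → ℕ → ℂ, (∀ q, IsPeriodicFn (fq q)) ∧
    Filter.Tendsto (fun q : ℕ =>
        Filter.limsup (fun x : ℕ => (∑ n ∈ Finset.Icc 1 x, ‖f n - fq q n‖ ^ 2) / x)
          Filter.atTop)
      Filter.atTop (nhds 0)

/-- The Fourier coefficient `⟨f, e_β⟩ = lim_x (1/x) ∑_{n≤x} f n e(-βn)` equals `c`. -/
def HasFourierCoeff (f : ℕ → ℂ) (β : ℝ) (c : ℂ) : Prop :=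
  Filter.Tendsto (fun x : ℕ => (∑ n ∈ Finset.Icc 1 x, f n * e (-(β * n))) / (x : ℂ))
    Filter.atTop (nhds c)

/-- The spectrum of `f`: those `β` with nonzero Fourier coefficient. -/
def spec (f : ℕ → ℂ) : Set ℝ := {β | ∃ c : ℂ, c ≠ 0 ∧ HasFourierCoeff f β c}

/-- Major arcs `M_α(x,Q)` relative to a sequence `α`. -/
def majorArcsAlpha (α : ℕ → ℝ) (x Q : ℕ) : Set ℝ :=
  ⋃ n : ℕ, ⋃ _ : n ≤ Q, Set.Icc (α n - Q / x) (α n + Q / x)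

/-- Minor arcs `m_α(x,Q) = [0,1] \ M_α(x,Q)`. -/
def minorArcsAlpha (α : ℕ → ℝ) (x Q : ℕ) : Set ℝ := Set.Icc 0 1 \ majorArcsAlpha α x Q

/-- `N` is `α`-extremal: it has positive density, all Fourier coefficients of its
characteristic function exist, and `∫_{m_α(x,Q(x))} |S|² = o(x)` for every `Q(x) → ∞`. -/
def AlphaExtremal (N : Set ℕ) (α : ℕ → ℝ) : Prop :=
  (∃ ρ : ℝ, 0 < ρ ∧ HasDensity N ρ) ∧
  (∀ β : ℝ, ∃ c : ℂ, HasFourierCoeff (charFun N) β c) ∧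
  ∀ Q : ℕ → ℕ, Filter.Tendsto Q Filter.atTop Filter.atTop →
    Filter.Tendsto (fun x : ℕ =>
        (∫ θ in minorArcsAlpha α x (Q x), ‖expSum N x θ‖ ^ 2) / x)
      Filter.atTop (nhds 0)

/-- The centred indicator function of the multiples of `p`. -/
noncomputable def centredDvd (p n : ℕ) : ℝ := (if p ∣ n then 1 else 0) - 1 / p

lemma sum_ite_dvd_eq_div (x d : ℕ) :
    ∑ n ∈ Finset.Icc 1 x, (if d ∣ n then (1 : ℝ) else 0) = ((x / d : ℕ) : ℝ) := by
  rw [← Finset.sum_filter, Finset.sum_const, nsmul_eq_mul, mul_one,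
    ← Nat.Ioc_filter_dvd_card_eq_div x d]
  congr 2

lemma natDiv_cast_bounds (x d : ℕ) (hd : 0 < d) :
    (x : ℝ) / d - 1 ≤ ((x / d : ℕ) : ℝ) ∧ ((x / d : ℕ) : ℝ) ≤ (x : ℝ) / d := by
  refine ⟨?_, Nat.cast_div_le⟩
  have hd' : (0 : ℝ) < d := by exact_mod_cast hd
  have h := (Nat.lt_div_mul_add hd : x < x / d * d + d)
  have h' : (x : ℝ) < ((x / d : ℕ) : ℝ) * d + d := by exact_mod_cast h
  rw [sub_le_iff_le_add, div_le_iff₀ hd']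
  linarith

lemma sum_centredDvd_sq_le (x p : ℕ) (hp : p.Prime) :
    ∑ n ∈ Finset.Icc 1 x, centredDvd p n * centredDvd p n ≤ (x : ℝ) / p := by
  have hp0 : (0 : ℝ) < p := by exact_mod_cast hp.pos
  have hp2 : (2 : ℝ) ≤ p := by exact_mod_cast hp.two_le
  have key : ∑ n ∈ Finset.Icc 1 x, centredDvd p n * centredDvd p n
      = (1 - 2 / p) * ((x / p : ℕ) : ℝ) + x * (1 / p) ^ 2 := by
    rw [← sum_ite_dvd_eq_div, Finset.mul_sum]
    have hc : (x : ℝ) * (1 / p) ^ 2 = ∑ n ∈ Finset.Icc 1 x, (1 / (p : ℝ)) ^ 2 := by simp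
    rw [hc, ← Finset.sum_add_distrib]
    refine Finset.sum_congr rfl fun n _ => ?_
    unfold centredDvd
    split_ifs <;> ring
  rw [key]
  have h1 : 0 ≤ 1 - 2 / (p : ℝ) := by
    rw [sub_nonneg, div_le_one hp0]; exact hp2
  have h2 := mul_le_mul_of_nonneg_left (natDiv_cast_bounds x p hp.pos).2 h1
  have h3 : (1 - 2 / (p : ℝ)) * (x / p) + x * (1 / p) ^ 2 = x / p - x * (1 / p) ^ 2 := by ring
  have : 0 ≤ (x : ℝ) * (1 / p) ^ 2 := by positivity
  linarith

lemma abs_sum_centredDvd_mul_le (x p q : ℕ) (hp : p.Prime) (hq : q.Prime) (hpq : p ≠ q) :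
    |∑ n ∈ Finset.Icc 1 x, centredDvd p n * centredDvd q n| ≤ 1 := by
  have hp2 : (2 : ℝ) ≤ p := by exact_mod_cast hp.two_le
  have hq2 : (2 : ℝ) ≤ q := by exact_mod_cast hq.two_le
  have hip : 1 / (p : ℝ) ≤ 1 / 2 := one_div_le_one_div_of_le two_pos hp2
  have hiq : 1 / (q : ℝ) ≤ 1 / 2 := one_div_le_one_div_of_le two_pos hq2
  have hip0 : 0 ≤ 1 / (p : ℝ) := by positivity
  have hiq0 : 0 ≤ 1 / (q : ℝ) := by positivity
  have key : ∑ n ∈ Finset.Icc 1 x, centredDvd p n * centredDvd q n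
      = ((x / (p * q) : ℕ) : ℝ) - 1 / q * ((x / p : ℕ) : ℝ) - 1 / p * ((x / q : ℕ) : ℝ)
        + x * (1 / p * (1 / q)) := by
    rw [← sum_ite_dvd_eq_div, ← sum_ite_dvd_eq_div, ← sum_ite_dvd_eq_div, Finset.mul_sum,
      Finset.mul_sum]
    have hc : (x : ℝ) * (1 / p * (1 / q)) = ∑ n ∈ Finset.Icc 1 x, (1 / (p : ℝ) * (1 / q)) := by
      simp
    rw [hc, ← Finset.sum_sub_distrib, ← Finset.sum_sub_distrib, ← Finset.sum_add_distrib]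
    refine Finset.sum_congr rfl fun n _ => ?_
    have hcop : Nat.Coprime p q := (Nat.coprime_primes hp hq).2 hpq
    have hdvd : p * q ∣ n ↔ p ∣ n ∧ q ∣ n :=
      ⟨fun h => ⟨dvd_of_mul_right_dvd h, dvd_of_mul_left_dvd h⟩,
        fun h => hcop.mul_dvd_of_dvd_of_dvd h.1 h.2⟩
    unfold centredDvd
    by_cases h1 : p ∣ n <;> by_cases h2 : q ∣ n <;> simp [hdvd, h1, h2] <;> ring
  obtain ⟨a1, a2⟩ := natDiv_cast_bounds x p hp.pos
  obtain ⟨b1, b2⟩ := natDiv_cast_bounds x q hq.pos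
  obtain ⟨c1, c2⟩ := natDiv_cast_bounds x (p * q) (Nat.mul_pos hp.pos hq.pos)
  have e1 : (x : ℝ) / ((p * q : ℕ) : ℝ) = x * (1 / p * (1 / q)) := by
    push_cast; field_simp
  have e2 : 1 / (q : ℝ) * (x / p) = x * (1 / p * (1 / q)) := by field_simp
  have e3 : 1 / (p : ℝ) * (x / q) = x * (1 / p * (1 / q)) := by field_simp
  have a1' := mul_le_mul_of_nonneg_left a1 hiq0
  have a2' := mul_le_mul_of_nonneg_left a2 hiq0
  have b1' := mul_le_mul_of_nonneg_left b1 hip0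
  have b2' := mul_le_mul_of_nonneg_left b2 hip0
  rw [mul_sub] at a1' b1'
  rw [key, abs_le]
  constructor <;> linarith

/-- The Turán–Kubilius inequality for real additive functions supported on primes up to `√x`. -/
lemma turan_kubilius_real (x z : ℕ) (hz : z * z ≤ x) (P : Finset ℕ)
    (hP : ∀ p ∈ P, p.Prime ∧ p ≤ z) (a : ℕ → ℝ) :
    ∑ n ∈ Finset.Icc 1 x, (∑ p ∈ P, a p * centredDvd p n) ^ 2
      ≤ 2 * x * ∑ p ∈ P, a p ^ 2 / p := by
  have hsum : ∑ p ∈ P, (p : ℝ) ≤ x := by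
    have hsub : P ⊆ Finset.Icc 1 z := fun p hp =>
      Finset.mem_Icc.2 ⟨(hP p hp).1.pos, (hP p hp).2⟩
    calc ∑ p ∈ P, (p : ℝ) ≤ ∑ p ∈ P, (z : ℝ) :=
          Finset.sum_le_sum fun p hp => by exact_mod_cast (hP p hp).2
      _ = P.card * z := by simp
      _ ≤ z * z := by
          have := Finset.card_le_card hsub
          rw [Nat.card_Icc, Nat.add_sub_cancel] at this
          gcongr
      _ ≤ x := by exact_mod_cast hz
  have hcs : (∑ p ∈ P, |a p|) ^ 2 ≤ (∑ p ∈ P, a p ^ 2 / p) * ∑ p ∈ P, (p : ℝ) := by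
    refine Finset.sum_sq_le_sum_mul_sum_of_sq_le_mul P (fun p _ => by positivity)
      (fun p _ => by positivity) fun p hp => ?_
    have : (p : ℝ) ≠ 0 := by exact_mod_cast (hP p hp).1.ne_zero
    rw [sq_abs]; field_simp; exact le_rfl
  have hS : 0 ≤ ∑ p ∈ P, a p ^ 2 / p := Finset.sum_nonneg fun p _ => by positivity
  have hexp : ∑ n ∈ Finset.Icc 1 x, (∑ p ∈ P, a p * centredDvd p n) ^ 2
      = ∑ p ∈ P, ∑ q ∈ P, a p * a q * ∑ n ∈ Finset.Icc 1 x, centredDvd p n * centredDvd q n := by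
    simp_rw [sq, Finset.sum_mul_sum, Finset.mul_sum]
    rw [Finset.sum_comm]
    refine Finset.sum_congr rfl fun p _ => ?_
    rw [Finset.sum_comm]
    exact Finset.sum_congr rfl fun q _ => Finset.sum_congr rfl fun n _ => by ring
  have hterm : ∀ p ∈ P, ∀ q ∈ P,
      a p * a q * ∑ n ∈ Finset.Icc 1 x, centredDvd p n * centredDvd q n
        ≤ (if p = q then x * (a p ^ 2 / p) else 0) + |a p| * |a q| := by
    intro p hp q hq
    split_ifs with h
    · subst h
      have h1 := mul_le_mul_of_nonneg_left (sum_centredDvd_sq_le x p (hP p hp).1)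
        (mul_self_nonneg (a p))
      have h2 : a p * a p * (x / p) = x * (a p ^ 2 / p) := by ring
      have h3 : 0 ≤ |a p| * |a p| := by positivity
      linarith
    · rw [zero_add]
      refine (le_abs_self _).trans ?_
      rw [abs_mul, abs_mul]
      exact mul_le_of_le_one_right (by positivity)
        (abs_sum_centredDvd_mul_le x p q (hP p hp).1 (hP q hq).1 h)
  rw [hexp]
  calc _ ≤ ∑ p ∈ P, ∑ q ∈ P,
        ((if p = q then x * (a p ^ 2 / p) else 0) + |a p| * |a q|) :=
        Finset.sum_le_sum fun p hp => Finset.sum_le_sum fun q hq => hterm p hp q hq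
    _ = x * ∑ p ∈ P, a p ^ 2 / p + (∑ p ∈ P, |a p|) ^ 2 := by
        simp_rw [Finset.sum_add_distrib, sq (∑ p ∈ P, |a p|), Finset.sum_mul_sum, Finset.mul_sum]
        congr 1
        exact Finset.sum_congr rfl fun p hp => by simp [hp]
    _ ≤ x * ∑ p ∈ P, a p ^ 2 / p + (∑ p ∈ P, a p ^ 2 / p) * x := by
        gcongr
        exact hcs.trans (mul_le_mul_of_nonneg_left hsum hS)
    _ = _ := by ring

lemma turan_kubilius (x z : ℕ) (hz : z * z ≤ x) (P : Finset ℕ)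
    (hP : ∀ p ∈ P, p.Prime ∧ p ≤ z) (a : ℕ → ℂ) :
    ∑ n ∈ Finset.Icc 1 x, ‖∑ p ∈ P, a p * (centredDvd p n : ℂ)‖ ^ 2
      ≤ 2 * x * ∑ p ∈ P, ‖a p‖ ^ 2 / p := by
  have h1 := turan_kubilius_real x z hz P hP fun p => (a p).re
  have h2 := turan_kubilius_real x z hz P hP fun p => (a p).im
  have hn : ∀ w : ℂ, ‖w‖ ^ 2 = w.re ^ 2 + w.im ^ 2 := fun w => by
    rw [Complex.sq_norm, Complex.normSq_apply]; ring
  simp_rw [hn, Complex.re_sum, Complex.im_sum, Complex.re_mul_ofReal, Complex.im_mul_ofReal,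
    Finset.sum_add_distrib, add_div, Finset.sum_add_distrib, mul_add]
  exact add_le_add h1 h2

lemma dual_turan_kubilius_real (x z : ℕ) (hz : z * z ≤ x) (P : Finset ℕ)
    (hP : ∀ p ∈ P, p.Prime ∧ p ≤ z) (h : ℕ → ℝ) :
    ∑ p ∈ P, p * (∑ n ∈ Finset.Icc 1 x, h n * centredDvd p n) ^ 2
      ≤ 2 * x * ∑ n ∈ Finset.Icc 1 x, h n ^ 2 := by
  set b : ℕ → ℝ := fun p => ∑ n ∈ Finset.Icc 1 x, h n * centredDvd p n with hb
  set S : ℝ := ∑ p ∈ P, p * b p ^ 2 with hS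
  change S ≤ _
  have hS0 : 0 ≤ S := Finset.sum_nonneg fun p _ => by positivity
  have h1 : S = ∑ n ∈ Finset.Icc 1 x, h n * ∑ p ∈ P, (p * b p) * centredDvd p n := by
    simp_rw [Finset.mul_sum]
    rw [Finset.sum_comm]
    refine Finset.sum_congr rfl fun p _ => ?_
    calc (p : ℝ) * b p ^ 2 = (p * b p) * ∑ n ∈ Finset.Icc 1 x, h n * centredDvd p n := by
          rw [sq, ← mul_assoc]
      _ = _ := by
          rw [Finset.mul_sum]
          exact Finset.sum_congr rfl fun n _ => by ring
  have h2 := Finset.sum_mul_sq_le_sq_mul_sq (Finset.Icc 1 x) h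
    fun n => ∑ p ∈ P, (p * b p) * centredDvd p n
  rw [← h1] at h2
  have h3 := turan_kubilius_real x z hz P hP fun p => p * b p
  have h4 : ∑ p ∈ P, (p * b p) ^ 2 / (p : ℝ) = S := by
    refine Finset.sum_congr rfl fun p hp => ?_
    have : (p : ℝ) ≠ 0 := by exact_mod_cast (hP p hp).1.ne_zero
    field_simp
  rw [h4] at h3
  set H : ℝ := ∑ n ∈ Finset.Icc 1 x, h n ^ 2
  have hH : 0 ≤ H := Finset.sum_nonneg fun n _ => by positivity
  have h5 : S * S ≤ (2 * x * H) * S := by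
    have := h2.trans (mul_le_mul_of_nonneg_left h3 hH)
    rw [sq] at this
    linarith
  rcases hS0.eq_or_lt with h0 | h0
  · rw [← h0]; positivity
  · exact le_of_mul_le_mul_right h5 h0

/-- The dual form of the Turán–Kubilius inequality. -/
lemma dual_turan_kubilius (x z : ℕ) (hz : z * z ≤ x) (P : Finset ℕ)
    (hP : ∀ p ∈ P, p.Prime ∧ p ≤ z) (h : ℕ → ℂ) :
    ∑ p ∈ P, p * ‖∑ n ∈ Finset.Icc 1 x, h n * (centredDvd p n : ℂ)‖ ^ 2
      ≤ 2 * x * ∑ n ∈ Finset.Icc 1 x, ‖h n‖ ^ 2 := by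
  have h1 := dual_turan_kubilius_real x z hz P hP fun p => (h p).re
  have h2 := dual_turan_kubilius_real x z hz P hP fun p => (h p).im
  have hn : ∀ w : ℂ, ‖w‖ ^ 2 = w.re ^ 2 + w.im ^ 2 := fun w => by
    rw [Complex.sq_norm, Complex.normSq_apply]; ring
  simp_rw [hn, Complex.re_sum, Complex.im_sum, Complex.re_mul_ofReal, Complex.im_mul_ofReal,
    Finset.sum_add_distrib, mul_add, Finset.sum_add_distrib]
  exact add_le_add h1 h2

lemma norm_sub_exp_sub_one_le {u : ℂ} (hu : ‖u‖ ≤ 1) :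
    ‖u - Complex.exp (u - 1)‖ ≤ 2 * ‖u - 1‖ ^ 2 := by
  rcases le_or_gt ‖u - 1‖ 1 with h | h
  · have := Complex.norm_exp_sub_one_sub_id_le h
    rw [← norm_neg] at this
    have e1 : -(Complex.exp (u - 1) - 1 - (u - 1)) = u - Complex.exp (u - 1) := by ring
    rw [e1] at this
    nlinarith [sq_nonneg ‖u - 1‖]
  · have h1 : ‖Complex.exp (u - 1)‖ ≤ 1 := by
      rw [Complex.norm_exp, Real.exp_le_one_iff]
      have := Complex.re_le_norm u
      simp; linarith
    have h2 := norm_sub_le u (Complex.exp (u - 1))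
    nlinarith

lemma norm_exp_le_one {w : ℂ} (hw : w.re ≤ 0) : ‖Complex.exp w‖ ≤ 1 := by
  rw [Complex.norm_exp, Real.exp_le_one_iff]; exact hw

lemma norm_exp_sub_exp_le {v w : ℂ} (hv : v.re ≤ 0) (hw : w.re ≤ 0) :
    ‖Complex.exp w - Complex.exp v‖ ≤ ‖w - v‖ := by
  have := Convex.norm_image_sub_le_of_norm_hasDerivWithin_le (𝕜 := ℂ) (f := Complex.exp)
    (f' := Complex.exp) (s := {w : ℂ | w.re ≤ 0}) (C := 1) (x := v) (y := w)
    (fun x _ => (Complex.hasDerivAt_exp x).hasDerivWithinAt)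
    (fun x hx => norm_exp_le_one hx) (convex_halfSpace_re_le 0) hv hw
  simpa using this

lemma norm_prod_sub_prod_le_sum {ι : Type*} (s : Finset ι) (u v : ι → ℂ)
    (hu : ∀ i ∈ s, ‖u i‖ ≤ 1) (hv : ∀ i ∈ s, ‖v i‖ ≤ 1) :
    ‖∏ i ∈ s, u i - ∏ i ∈ s, v i‖ ≤ ∑ i ∈ s, ‖u i - v i‖ := by
  induction s using Finset.induction_on with
  | empty => simp
  | insert a s ha ih =>
    rw [Finset.prod_insert ha, Finset.prod_insert ha, Finset.sum_insert ha]
    have ih' := ih (fun i hi => hu i (Finset.mem_insert_of_mem hi))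
      (fun i hi => hv i (Finset.mem_insert_of_mem hi))
    have h1 : ‖∏ i ∈ s, u i‖ ≤ 1 := by
      rw [norm_prod]
      exact Finset.prod_le_one (fun i _ => norm_nonneg _)
        fun i hi => hu i (Finset.mem_insert_of_mem hi)
    have h2 := hv a (Finset.mem_insert_self a s)
    calc ‖u a * ∏ i ∈ s, u i - v a * ∏ i ∈ s, v i‖
        = ‖(u a - v a) * ∏ i ∈ s, u i + v a * (∏ i ∈ s, u i - ∏ i ∈ s, v i)‖ := by
          congr 1; ring
      _ ≤ ‖u a - v a‖ * ‖∏ i ∈ s, u i‖ + ‖v a‖ * ‖∏ i ∈ s, u i - ∏ i ∈ s, v i‖ := by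
          rw [← norm_mul, ← norm_mul]; exact norm_add_le _ _
      _ ≤ ‖u a - v a‖ * 1 + 1 * ∑ i ∈ s, ‖u i - v i‖ := by gcongr
      _ = _ := by ring

lemma re_sub_one_nonpos {u : ℂ} (hu : ‖u‖ ≤ 1) : (u - 1).re ≤ 0 := by
  have := Complex.re_le_norm u
  simp; linarith

lemma norm_sub_le_two {u v : ℂ} (hu : ‖u‖ ≤ 1) (hv : ‖v‖ ≤ 1) : ‖u - v‖ ≤ 2 := by
  linarith [norm_sub_le u v]

lemma map_one_of_multiplicative {f : ℕ → ℂ}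
    (hmul : ∀ m n : ℕ, Nat.Coprime m n → f (m * n) = f m * f n) {d : ℕ} (hd : f d ≠ 0) :
    f 1 = 1 := by
  have := hmul d 1 (Nat.coprime_one_right d)
  rw [mul_one] at this
  exact (mul_right_eq_self₀.1 this.symm).resolve_right hd

lemma map_eq_prod_primeFactors_of_squarefree {f : ℕ → ℂ}
    (hmul : ∀ m n : ℕ, Nat.Coprime m n → f (m * n) = f m * f n) (h1 : f 1 = 1)
    {m : ℕ} (hm : Squarefree m) : f m = ∏ p ∈ m.primeFactors, f p := by
  have key : ∀ s : Finset ℕ, (∀ p ∈ s, p.Prime) → f (∏ p ∈ s, p) = ∏ p ∈ s, f p := by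
    intro s
    induction s using Finset.induction_on with
    | empty => intro _; simpa using h1
    | insert a s ha ih =>
      intro hs
      rw [Finset.prod_insert ha, Finset.prod_insert ha, hmul, ih]
      · exact fun p hp => hs p (Finset.mem_insert_of_mem hp)
      · refine Nat.Coprime.prod_right fun p hp => ?_
        refine (Nat.coprime_primes (hs a (Finset.mem_insert_self a s))
          (hs p (Finset.mem_insert_of_mem hp))).2 ?_
        rintro rfl; exact ha hp
  have := key m.primeFactors fun p hp => Nat.prime_of_mem_primeFactors hp
  rwa [Nat.prod_primeFactors_of_squarefree hm] at this

/-- The modulus whose greatest common divisor with `n` is usually the `y`-smooth part of `n`. -/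
def smoothModulus (y : ℕ) : ℕ := primorial y ^ (2 * y)

lemma smoothModulus_pos (y : ℕ) : 0 < smoothModulus y := pow_pos (primorial_pos y) _

lemma prime_le_of_dvd_smoothModulus {y p : ℕ} (hp : p.Prime) (h : p ∣ smoothModulus y) :
    p ≤ y := (hp.dvd_primorial_iff).1 (hp.dvd_of_dvd_pow h)

/-- If no square of an integer exceeding `y` divides `n`, then `n` splits as its `y`-smooth part
times a squarefree number. -/
lemma smooth_decomposition {y n : ℕ} (hn : n ≠ 0) (hgood : ∀ m, y < m → ¬ m ^ 2 ∣ n) :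
    ∃ m, n = Nat.gcd n (smoothModulus y) * m ∧ Nat.Coprime (Nat.gcd n (smoothModulus y)) m ∧
      Squarefree m ∧ m.primeFactors = n.primeFactors.filter (fun p => y < p) := by
  set d := Nat.gcd n (smoothModulus y) with hd
  have hdn : d ∣ n := Nat.gcd_dvd_left _ _
  obtain ⟨m, hm⟩ := hdn
  have hd0 : d ≠ 0 := by rintro h; rw [h, zero_mul] at hm; exact hn hm
  have hm0 : m ≠ 0 := by rintro h; rw [h, mul_zero] at hm; exact hn hm
  have hlarge : ∀ p, p.Prime → p ∣ m → y < p := by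
    intro p hp hpm
    by_contra hle
    push Not at hle
    obtain ⟨k, hk⟩ : ∃ k, d.factorization p = k := ⟨_, rfl⟩
    have hpk : p ^ k ∣ d := hk ▸ Nat.ordProj_dvd d p
    have hpk1 : p ^ (k + 1) ∣ n := by
      rw [hm, pow_succ]; exact Nat.mul_dvd_mul hpk hpm
    have hk2 : k < 2 * y := by
      by_contra hc
      push Not at hc
      refine hgood (p ^ y) (Nat.lt_pow_self hp.one_lt) ?_
      rw [← pow_mul, mul_comm]
      exact ((pow_dvd_pow p hc).trans hpk).trans (Dvd.intro m hm.symm)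
    have hQ : p ^ (k + 1) ∣ smoothModulus y := by
      refine (pow_dvd_pow p (by omega : k + 1 ≤ 2 * y)).trans ?_
      exact pow_dvd_pow_of_dvd ((hp.dvd_primorial_iff).2 hle) _
    have h3 := (hp.pow_dvd_iff_le_factorization hd0).1 (Nat.dvd_gcd hpk1 hQ)
    omega
  have hcop : Nat.Coprime d m := Nat.coprime_of_dvd fun p hp hpd hpm =>
    absurd (prime_le_of_dvd_smoothModulus hp (hpd.trans (Nat.gcd_dvd_right _ _)))
      (not_le.2 (hlarge p hp hpm))
  refine ⟨m, hm, hcop, ?_, ?_⟩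
  · rw [Nat.squarefree_iff_prime_squarefree]
    intro p hp hpp
    refine hgood p (hlarge p hp (dvd_of_mul_right_dvd hpp)) ?_
    rw [sq, hm]; exact hpp.mul_left d
  · ext p
    simp only [Nat.mem_primeFactors, Finset.mem_filter]
    constructor
    · rintro ⟨hp, hpm, -⟩
      exact ⟨⟨hp, hm ▸ hpm.mul_left d, hn⟩, hlarge p hp hpm⟩
    · rintro ⟨⟨hp, hpn, -⟩, hy⟩
      refine ⟨hp, ?_, hm0⟩
      rw [hm] at hpn
      refine (hp.dvd_mul.1 hpn).resolve_left fun hpd => ?_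
      exact absurd (prime_le_of_dvd_smoothModulus hp (hpd.trans (Nat.gcd_dvd_right _ _)))
        (not_le.2 hy)

lemma card_filter_exists_sq_dvd_le (x y : ℕ) (hy : 1 ≤ y) :
    (((Finset.Icc 1 x).filter (fun n => ∃ m, y < m ∧ m ^ 2 ∣ n)).card : ℝ) ≤ x / y := by
  have hsub : (Finset.Icc 1 x).filter (fun n => ∃ m, y < m ∧ m ^ 2 ∣ n)
      ⊆ (Finset.Ioc y (max x y)).biUnion
        fun m => (Finset.Icc 1 x).filter (fun n => m ^ 2 ∣ n) := by
    intro n hn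
    simp only [Finset.mem_filter, Finset.mem_biUnion, Finset.mem_Icc, Finset.mem_Ioc] at hn ⊢
    obtain ⟨⟨h1, h2⟩, m, hm, hmn⟩ := hn
    have : m ^ 2 ≤ n := Nat.le_of_dvd h1 hmn
    have hmm : m ≤ m ^ 2 := Nat.le_self_pow two_ne_zero m
    exact ⟨m, ⟨hm, le_max_of_le_left (by omega)⟩, ⟨h1, h2⟩, hmn⟩
  have h1 : (((Finset.Icc 1 x).filter (fun n => ∃ m, y < m ∧ m ^ 2 ∣ n)).card : ℝ)
      ≤ ∑ m ∈ Finset.Ioc y (max x y), (x : ℝ) * ((m : ℝ) ^ 2)⁻¹ := by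
    refine le_trans (Nat.cast_le.2 ((Finset.card_le_card hsub).trans Finset.card_biUnion_le)) ?_
    push_cast
    refine Finset.sum_le_sum fun m hm => ?_
    have h2 := sum_ite_dvd_eq_div x (m ^ 2)
    rw [← Finset.sum_filter, Finset.sum_const, nsmul_eq_mul, mul_one] at h2
    rw [h2, ← div_eq_mul_inv]
    have := @Nat.cast_div_le ℝ _ _ _ x (m ^ 2)
    push_cast at this
    exact this
  refine h1.trans ?_
  rw [← Finset.mul_sum, div_eq_mul_inv]
  refine mul_le_mul_of_nonneg_left ?_ (by positivity)
  refine (sum_Ioc_inv_sq_le_sub (by omega) (le_max_right x y)).trans ?_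
  exact sub_le_self _ (by positivity)

/-- The partial sum of `(f p - 1) / p` over the primes `y < p ≤ z`. -/
noncomputable def primeSum (f : ℕ → ℂ) (y z : ℕ) : ℂ :=
  ∑ p ∈ (Finset.Ioc y z).filter Nat.Prime, (f p - 1) / (p : ℂ)

lemma primeSum_re_nonpos {f : ℕ → ℂ} (hb : ∀ n, ‖f n‖ ≤ 1) (y z : ℕ) :
    (primeSum f y z).re ≤ 0 := by
  unfold primeSum
  rw [Complex.re_sum]
  refine Finset.sum_nonpos fun p _ => ?_
  rw [Complex.div_natCast_re]
  exact div_nonpos_of_nonpos_of_nonneg (re_sub_one_nonpos (hb p)) (Nat.cast_nonneg p)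

lemma sum_sum_filter_dvd_le (x : ℕ) (P : Finset ℕ) (c : ℕ → ℝ) (hc : ∀ p, 0 ≤ c p) :
    ∑ n ∈ Finset.Icc 1 x, ∑ p ∈ P.filter (· ∣ n), c p ≤ x * ∑ p ∈ P, c p / p := by
  simp_rw [Finset.sum_filter]
  rw [Finset.sum_comm, Finset.mul_sum]
  refine Finset.sum_le_sum fun p _ => ?_
  have h1 : ∑ n ∈ Finset.Icc 1 x, (if p ∣ n then c p else 0)
      = c p * ((x / p : ℕ) : ℝ) := by
    rw [← sum_ite_dvd_eq_div, Finset.mul_sum]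
    exact Finset.sum_congr rfl fun n _ => by split_ifs <;> simp
  rw [h1]
  calc c p * ((x / p : ℕ) : ℝ) ≤ c p * (x / p) :=
        mul_le_mul_of_nonneg_left Nat.cast_div_le (hc p)
    _ = _ := by ring

lemma card_filter_dvd_large_primes_le_one {x n : ℕ} (hn : n ∈ Finset.Icc 1 x) (P : Finset ℕ)
    (hP : ∀ p ∈ P, p.Prime ∧ Nat.sqrt x < p) : (P.filter (· ∣ n)).card ≤ 1 := by
  rw [Finset.card_le_one]
  intro p hp q hq
  rw [Finset.mem_filter] at hp hq
  by_contra hpq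
  obtain ⟨hpp, hpx⟩ := hP p hp.1
  obtain ⟨hqp, hqx⟩ := hP q hq.1
  have h1 : p * q ∣ n :=
    ((Nat.coprime_primes hpp hqp).2 hpq).mul_dvd_of_dvd_of_dvd hp.2 hq.2
  rw [Finset.mem_Icc] at hn
  have h2 := Nat.le_of_dvd hn.1 h1
  have h3 : (Nat.sqrt x + 1) * (Nat.sqrt x + 1) ≤ p * q := Nat.mul_le_mul hpx hqx
  have h4 := Nat.lt_succ_sqrt x
  rw [Nat.succ_eq_add_one] at h4
  omega

lemma norm_sum_filter_sq_le {x n : ℕ} (hn : n ∈ Finset.Icc 1 x) (P : Finset ℕ)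
    (hP : ∀ p ∈ P, p.Prime ∧ Nat.sqrt x < p) (a : ℕ → ℂ) :
    ‖∑ p ∈ P.filter (· ∣ n), a p‖ ^ 2 ≤ ∑ p ∈ P.filter (· ∣ n), ‖a p‖ ^ 2 := by
  have h1 := card_filter_dvd_large_primes_le_one hn P hP
  rcases Nat.le_one_iff_eq_zero_or_eq_one.1 h1 with h | h
  · rw [Finset.card_eq_zero] at h; simp [h]
  · obtain ⟨q, hq⟩ := Finset.card_eq_one.1 h; simp [hq]

lemma norm_prod_sub_exp_sum_sq_le (s : Finset ℕ) (f : ℕ → ℂ) (hb : ∀ n, ‖f n‖ ≤ 1) :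
    ‖∏ p ∈ s, f p - Complex.exp (∑ p ∈ s, (f p - 1))‖ ^ 2 ≤ 4 * ∑ p ∈ s, ‖f p - 1‖ ^ 2 := by
  have h1 : ‖∏ p ∈ s, f p - Complex.exp (∑ p ∈ s, (f p - 1))‖
      ≤ 2 * ∑ p ∈ s, ‖f p - 1‖ ^ 2 := by
    rw [Complex.exp_sum, Finset.mul_sum]
    refine (norm_prod_sub_prod_le_sum s _ _ (fun p _ => hb p)
      fun p _ => norm_exp_le_one (re_sub_one_nonpos (hb p))).trans ?_
    exact Finset.sum_le_sum fun p _ => norm_sub_exp_sub_one_le (hb p)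
  have h2 : ‖∏ p ∈ s, f p - Complex.exp (∑ p ∈ s, (f p - 1))‖ ≤ 2 := by
    refine norm_sub_le_two ?_ (norm_exp_le_one ?_)
    · rw [norm_prod]; exact Finset.prod_le_one (fun p _ => norm_nonneg _) fun p _ => hb p
    · rw [Complex.re_sum]; exact Finset.sum_nonpos fun p _ => re_sub_one_nonpos (hb p)
  nlinarith [norm_nonneg (∏ p ∈ s, f p - Complex.exp (∑ p ∈ s, (f p - 1)))]

lemma norm_add_three_sq_le (a b c : ℂ) :
    ‖a + b + c‖ ^ 2 ≤ 3 * ‖a‖ ^ 2 + 3 * ‖b‖ ^ 2 + 3 * ‖c‖ ^ 2 := by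
  have h := norm_add₃_le (a := a) (b := b) (c := c)
  have h2 := pow_le_pow_left₀ (norm_nonneg _) h 2
  nlinarith [sq_nonneg (‖a‖ - ‖b‖), sq_nonneg (‖b‖ - ‖c‖), sq_nonneg (‖a‖ - ‖c‖)]

lemma norm_sub_smooth_mul_exp_sq_le {f : ℕ → ℂ}
    (hmul : ∀ m n : ℕ, Nat.Coprime m n → f (m * n) = f m * f n)
    (hb : ∀ n, ‖f n‖ ≤ 1) (h1 : f 1 = 1) {x y n : ℕ} (hn : n ∈ Finset.Icc 1 x)
    (hgood : ∀ m, y < m → ¬ m ^ 2 ∣ n) (P : Finset ℕ)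
    (hP : P = (Finset.Ioc y x).filter Nat.Prime) :
    ‖f n - f (Nat.gcd n (smoothModulus y)) * Complex.exp (primeSum f y (Nat.sqrt x))‖ ^ 2
      ≤ 15 * ∑ p ∈ P.filter (· ∣ n), ‖f p - 1‖ ^ 2
        + 3 * ‖∑ p ∈ P.filter (· ≤ Nat.sqrt x), (f p - 1) * (centredDvd p n : ℂ)‖ ^ 2 := by
  have hn' := Finset.mem_Icc.1 hn
  obtain ⟨m, hnm, hcop, hsq, hpf⟩ := smooth_decomposition (by omega) hgood
  set d := Nat.gcd n (smoothModulus y)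
  set A := primeSum f y (Nat.sqrt x) with hA
  set P₁ := P.filter (· ≤ Nat.sqrt x) with hP₁
  set P₂ := P.filter (fun p => ¬ p ≤ Nat.sqrt x) with hP₂
  have hs : m.primeFactors = P.filter (· ∣ n) := by
    rw [hpf, hP]
    ext p
    simp only [Finset.mem_filter, Nat.mem_primeFactors, Finset.mem_Ioc]
    constructor
    · rintro ⟨⟨a, b, -⟩, c⟩
      exact ⟨⟨⟨c, (Nat.le_of_dvd (by omega) b).trans hn'.2⟩, a⟩, b⟩
    · rintro ⟨⟨⟨a, -⟩, b⟩, c⟩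
      exact ⟨⟨b, c, by omega⟩, a⟩
  have hf : f n = f d * ∏ p ∈ P.filter (· ∣ n), f p := by
    rw [← hs, ← map_eq_prod_primeFactors_of_squarefree hmul h1 hsq, ← hmul d m hcop, ← hnm]
  set s := P.filter (· ∣ n) with hs'
  have hA1 : A = ∑ p ∈ P₁, (f p - 1) / (p : ℂ) := by
    rw [hA, primeSum]
    refine Finset.sum_congr ?_ fun _ _ => rfl
    rw [hP₁, hP]
    ext p
    simp only [Finset.mem_filter, Finset.mem_Ioc]
    have := Nat.sqrt_le_self x
    constructor
    · rintro ⟨⟨a, b⟩, c⟩; exact ⟨⟨⟨a, by omega⟩, c⟩, b⟩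
    · rintro ⟨⟨⟨a, b⟩, c⟩, e⟩; exact ⟨⟨a, e⟩, c⟩
  have hw : ∑ p ∈ s, (f p - 1) - A
      = ∑ p ∈ P₁, (f p - 1) * (centredDvd p n : ℂ) + ∑ p ∈ P₂.filter (· ∣ n), (f p - 1) := by
    have e1 : ∑ p ∈ s, (f p - 1)
        = ∑ p ∈ P₁.filter (· ∣ n), (f p - 1) + ∑ p ∈ P₂.filter (· ∣ n), (f p - 1) := by
      rw [← Finset.sum_filter_add_sum_filter_not s (· ≤ Nat.sqrt x), hs', hP₁, hP₂]
      congr 2 <;> exact Finset.filter_comm _ _ _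
    have e2 : ∑ p ∈ P₁, (f p - 1) * (centredDvd p n : ℂ)
        = ∑ p ∈ P₁.filter (· ∣ n), (f p - 1) - A := by
      rw [hA1, Finset.sum_filter (s := P₁) (· ∣ n), ← Finset.sum_sub_distrib]
      refine Finset.sum_congr rfl fun p _ => ?_
      unfold centredDvd
      split_ifs <;> push_cast <;> ring
    rw [e1, e2]; ring
  set w := ∑ p ∈ s, (f p - 1) with hw'
  have hwre : w.re ≤ 0 := by
    rw [hw', Complex.re_sum]; exact Finset.sum_nonpos fun p _ => re_sub_one_nonpos (hb p)
  have hAre : A.re ≤ 0 := primeSum_re_nonpos hb _ _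
  have hmain : ‖f n - f d * Complex.exp A‖ ≤
      ‖∏ p ∈ s, f p - Complex.exp w‖ + ‖w - A‖ := by
    have e : f n - f d * Complex.exp A
        = f d * ((∏ p ∈ s, f p - Complex.exp w) + (Complex.exp w - Complex.exp A)) := by
      rw [hf]; ring
    rw [e, norm_mul]
    refine (mul_le_of_le_one_left (norm_nonneg _) (hb d)).trans ((norm_add_le _ _).trans ?_)
    gcongr
    exact norm_exp_sub_exp_le hAre hwre
  have hP2 : ∀ p ∈ P₂, p.Prime ∧ Nat.sqrt x < p := by
    intro p hp
    rw [hP₂, Finset.mem_filter, hP, Finset.mem_filter] at hp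
    exact ⟨hp.1.2, not_le.1 hp.2⟩
  have b1 := norm_prod_sub_exp_sum_sq_le s f hb
  have b2 := norm_sum_filter_sq_le hn P₂ hP2 fun p => f p - 1
  have b3 : ∑ p ∈ P₂.filter (· ∣ n), ‖f p - 1‖ ^ 2 ≤ ∑ p ∈ s, ‖f p - 1‖ ^ 2 := by
    refine Finset.sum_le_sum_of_subset_of_nonneg ?_ fun _ _ _ => by positivity
    exact Finset.filter_subset_filter _ (Finset.filter_subset _ _)
  rw [hw] at hmain
  have hmain' := pow_le_pow_left₀ (norm_nonneg _) hmain 2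
  have b4 := norm_add_le (∑ p ∈ P₁, (f p - 1) * (centredDvd p n : ℂ))
    (∑ p ∈ P₂.filter (· ∣ n), (f p - 1))
  set α := ‖∏ p ∈ s, f p - Complex.exp w‖
  set β := ‖∑ p ∈ P₁, (f p - 1) * (centredDvd p n : ℂ)‖
  set γ := ‖∑ p ∈ P₂.filter (· ∣ n), (f p - 1)‖
  have b5 : ‖f n - f d * Complex.exp A‖ ^ 2 ≤ (α + (β + γ)) ^ 2 := by
    refine pow_le_pow_left₀ (norm_nonneg _) (hmain.trans ?_) 2
    gcongr
  nlinarith [sq_nonneg (α - β), sq_nonneg (β - γ), sq_nonneg (α - γ)]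

/-- A multiplicative function is close in mean square to its smooth part times a constant. -/
lemma sum_norm_sub_smooth_mul_exp_sq_le {f : ℕ → ℂ}
    (hmul : ∀ m n : ℕ, Nat.Coprime m n → f (m * n) = f m * f n)
    (hb : ∀ n, ‖f n‖ ≤ 1) (h1 : f 1 = 1) (x y : ℕ) (hy : 1 ≤ y) :
    ∑ n ∈ Finset.Icc 1 x,
        ‖f n - f (Nat.gcd n (smoothModulus y)) * Complex.exp (primeSum f y (Nat.sqrt x))‖ ^ 2
      ≤ x * (4 / y + 21 * ∑ p ∈ (Finset.Ioc y x).filter Nat.Prime, ‖f p - 1‖ ^ 2 / p) := by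
  set P := (Finset.Ioc y x).filter Nat.Prime with hP
  set P₁ := P.filter (· ≤ Nat.sqrt x) with hP₁
  set T := ∑ p ∈ P, ‖f p - 1‖ ^ 2 / p
  have hpt : ∀ n ∈ Finset.Icc 1 x,
      ‖f n - f (Nat.gcd n (smoothModulus y)) * Complex.exp (primeSum f y (Nat.sqrt x))‖ ^ 2
        ≤ 4 * (if ∃ m, y < m ∧ m ^ 2 ∣ n then (1 : ℝ) else 0)
          + (15 * ∑ p ∈ P.filter (· ∣ n), ‖f p - 1‖ ^ 2
            + 3 * ‖∑ p ∈ P₁, (f p - 1) * (centredDvd p n : ℂ)‖ ^ 2) := by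
    intro n hn
    split_ifs with h
    · have h2 : ‖f n - f (Nat.gcd n (smoothModulus y))
          * Complex.exp (primeSum f y (Nat.sqrt x))‖ ≤ 2 := by
        refine norm_sub_le_two (hb n) ?_
        rw [norm_mul]
        exact mul_le_one₀ (hb _) (norm_nonneg _) (norm_exp_le_one (primeSum_re_nonpos hb _ _))
      have h3 := pow_le_pow_left₀ (norm_nonneg _) h2 2
      have h4 : 0 ≤ 15 * ∑ p ∈ P.filter (· ∣ n), ‖f p - 1‖ ^ 2
            + 3 * ‖∑ p ∈ P₁, (f p - 1) * (centredDvd p n : ℂ)‖ ^ 2 := by positivity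
      linarith
    · push Not at h
      rw [mul_zero, zero_add]
      exact norm_sub_smooth_mul_exp_sq_le hmul hb h1 hn h P hP
  refine (Finset.sum_le_sum hpt).trans ?_
  rw [Finset.sum_add_distrib, Finset.sum_add_distrib, ← Finset.mul_sum, ← Finset.mul_sum,
    ← Finset.mul_sum, ← Finset.sum_filter, Finset.sum_const, nsmul_eq_mul, mul_one]
  have c1 := card_filter_exists_sq_dvd_le x y hy
  have c2 := sum_sum_filter_dvd_le x P (fun p => ‖f p - 1‖ ^ 2) fun p => by positivity
  have c3 := turan_kubilius x (Nat.sqrt x) (Nat.sqrt_le x) P₁ (fun p hp => by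
    rw [hP₁, Finset.mem_filter, hP, Finset.mem_filter] at hp
    exact ⟨hp.1.2, hp.2⟩) fun p => f p - 1
  have c4 : ∑ p ∈ P₁, ‖f p - 1‖ ^ 2 / (p : ℝ) ≤ T :=
    Finset.sum_le_sum_of_subset_of_nonneg (Finset.filter_subset _ _) fun _ _ _ => by positivity
  have c5 : 2 * (x : ℝ) * ∑ p ∈ P₁, ‖f p - 1‖ ^ 2 / (p : ℝ) ≤ 2 * x * T := by gcongr
  have c6 : (x : ℝ) * (4 / y + 21 * T) = 4 * (x / y) + 15 * (x * T) + 3 * (2 * x * T) := by ring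
  rw [c6]
  linarith

lemma sum_ite_dvd_eq_sum_mul (f : ℕ → ℂ) (x p : ℕ) (hp : 0 < p) :
    ∑ n ∈ Finset.Icc 1 x, (if p ∣ n then f n else 0) = ∑ m ∈ Finset.Icc 1 (x / p), f (p * m) := by
  rw [← Finset.sum_filter]
  symm
  refine Finset.sum_nbij (fun m => p * m) ?_ ?_ ?_ fun _ _ => rfl
  · intro m hm
    rw [Finset.mem_Icc] at hm
    rw [Finset.mem_filter, Finset.mem_Icc]
    exact ⟨⟨Nat.mul_pos hp hm.1, by rw [mul_comm]; exact (Nat.le_div_iff_mul_le hp).1 hm.2⟩,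
      dvd_mul_right p m⟩
  · intro a _ b _ hab
    exact Nat.eq_of_mul_eq_mul_left hp hab
  · intro n hn
    rw [Finset.mem_coe, Finset.mem_filter, Finset.mem_Icc] at hn
    obtain ⟨⟨h1, h2⟩, m, rfl⟩ := hn
    refine ⟨m, ?_, rfl⟩
    rw [Finset.mem_coe, Finset.mem_Icc]
    exact ⟨Nat.pos_of_mul_pos_left h1, (Nat.le_div_iff_mul_le hp).2 (by rwa [mul_comm])⟩

lemma norm_sum_multiples_sub_le {f : ℕ → ℂ}
    (hmul : ∀ m n : ℕ, Nat.Coprime m n → f (m * n) = f m * f n)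
    (hb : ∀ n, ‖f n‖ ≤ 1) (x p : ℕ) (hp : p.Prime) :
    ‖∑ n ∈ Finset.Icc 1 x, (if p ∣ n then f n else 0)
        - f p * ∑ m ∈ Finset.Icc 1 (x / p), f m‖ ≤ x * (2 / p ^ 2) := by
  rw [sum_ite_dvd_eq_sum_mul f x p hp.pos, Finset.mul_sum, ← Finset.sum_sub_distrib]
  have hpt : ∀ m ∈ Finset.Icc 1 (x / p),
      ‖f (p * m) - f p * f m‖ ≤ 2 * (if p ∣ m then (1 : ℝ) else 0) := by
    intro m _
    split_ifs with h
    · rw [mul_one]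
      refine norm_sub_le_two (hb _) ?_
      rw [norm_mul]
      exact mul_le_one₀ (hb _) (norm_nonneg _) (hb _)
    · rw [hmul p m ((Nat.Prime.coprime_iff_not_dvd hp).2 h)]; simp
  refine (norm_sum_le _ _).trans ((Finset.sum_le_sum hpt).trans ?_)
  rw [← Finset.mul_sum, sum_ite_dvd_eq_div]
  have h1 : ((x / p / p : ℕ) : ℝ) ≤ x / p / p :=
    Nat.cast_div_le.trans (div_le_div_of_nonneg_right Nat.cast_div_le (Nat.cast_nonneg p))
  calc (2 : ℝ) * ((x / p / p : ℕ) : ℝ) ≤ 2 * (x / p / p) := by gcongr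
    _ = _ := by ring

lemma tendsto_sum_natDiv {f : ℕ → ℂ} {M : ℂ}
    (hmean : Filter.Tendsto (fun x : ℕ => (∑ n ∈ Finset.Icc 1 x, f n) / (x : ℂ))
      Filter.atTop (nhds M)) {p : ℕ} (hp : 0 < p) :
    Filter.Tendsto (fun x : ℕ => (∑ n ∈ Finset.Icc 1 (x / p), f n) / (x : ℂ))
      Filter.atTop (nhds (M * (1 / p))) := by
  have h1 := hmean.comp (Nat.tendsto_div_const_atTop hp.ne')
  have h2 : Filter.Tendsto (fun x : ℕ => ((x / p : ℕ) : ℝ) / x) Filter.atTop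
      (nhds (1 / (p : ℝ))) := by
    have := (tendsto_nat_floor_mul_div_atTop (R := ℝ) (a := 1 / (p : ℝ)) (by positivity)).comp
      tendsto_natCast_atTop_atTop
    refine this.congr fun x => ?_
    simp only [Function.comp]
    rw [one_div_mul_eq_div, Nat.floor_div_eq_div]
  have h3 := (Complex.continuous_ofReal.tendsto _).comp h2
  have h4 := h1.mul h3
  push_cast at h4
  refine h4.congr' ?_
  filter_upwards [Filter.eventually_ge_atTop p] with x hx
  have : ((x / p : ℕ) : ℂ) ≠ 0 := by
    have : 0 < x / p := Nat.div_pos hx hp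
    exact_mod_cast this.ne'
  simp only [Function.comp]
  push_cast
  rw [div_mul_div_comm, mul_comm, mul_div_mul_left _ _ this]

/-- A nonzero mean value forces convergence of the quadratic series over primes. -/
lemma summable_of_mean_ne_zero {f : ℕ → ℂ}
    (hmul : ∀ m n : ℕ, Nat.Coprime m n → f (m * n) = f m * f n)
    (hb : ∀ n, ‖f n‖ ≤ 1) {M : ℂ} (hM : M ≠ 0)
    (hmean : Filter.Tendsto (fun x : ℕ => (∑ n ∈ Finset.Icc 1 x, f n) / (x : ℂ))
      Filter.atTop (nhds M)) :
    Summable (fun p : Nat.Primes => ‖f (p : ℕ) - 1‖ ^ 2 / ((p : ℕ) : ℝ)) := by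
  set K : ℝ := ∑' n : ℕ, ((n : ℝ) ^ 3)⁻¹ with hK
  have hKs : Summable fun n : ℕ => ((n : ℝ) ^ 3)⁻¹ := Real.summable_nat_pow_inv.2 (by norm_num)
  have hM0 : 0 < ‖M‖ := norm_pos_iff.2 hM
  set D : ℕ → ℕ → ℂ := fun p x => (f p * ∑ n ∈ Finset.Icc 1 (x / p), f n) / x
    - (1 / p) * ((∑ n ∈ Finset.Icc 1 x, f n) / x) with hD
  have key : ∀ P : Finset ℕ, (∀ p ∈ P, p.Prime) → ∀ᶠ x : ℕ in Filter.atTop,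
      ∑ p ∈ P, p * ‖D p x‖ ^ 2 ≤ 4 + 8 * K := by
    intro P hP
    set z := P.sup id with hz
    filter_upwards [Filter.eventually_ge_atTop (z * z + 1)] with x hx
    have hx0 : (0 : ℝ) < x := by
      have : 0 < x := by omega
      exact_mod_cast this
    have hdual := dual_turan_kubilius x z (by omega) P
      (fun p hp => ⟨hP p hp, Finset.le_sup (f := id) hp⟩) f
    have hsq : ∑ n ∈ Finset.Icc 1 x, ‖f n‖ ^ 2 ≤ x := by
      calc _ ≤ ∑ n ∈ Finset.Icc 1 x, (1 : ℝ) :=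
            Finset.sum_le_sum fun n _ => pow_le_one₀ (norm_nonneg _) (hb n)
        _ = x := by simp
    set b : ℕ → ℂ := fun p => ∑ n ∈ Finset.Icc 1 x, f n * (centredDvd p n : ℂ) with hbdef
    have hterm : ∀ p ∈ P, (p : ℝ) * ‖D p x‖ ^ 2
        ≤ 2 / (x : ℝ) ^ 2 * (p * ‖b p‖ ^ 2) + 8 * ((p : ℝ) ^ 3)⁻¹ := by
      intro p hp
      have hp0 : (0 : ℝ) < p := by exact_mod_cast (hP p hp).pos
      have hbp : b p = ∑ n ∈ Finset.Icc 1 x, (if p ∣ n then f n else 0)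
          - (1 / p) * ∑ n ∈ Finset.Icc 1 x, f n := by
        rw [hbdef, Finset.mul_sum, ← Finset.sum_sub_distrib]
        refine Finset.sum_congr rfl fun n _ => ?_
        unfold centredDvd
        split_ifs <;> push_cast <;> ring
      have h1 := norm_sum_multiples_sub_le hmul hb x p (hP p hp)
      have h2 : (x : ℝ) * ‖D p x‖ ≤ ‖b p‖ + x * (2 / p ^ 2) := by
        have hxc : (x : ℂ) ≠ 0 := by exact_mod_cast hx0.ne'
        have e1 : (x : ℂ) * D p x = b p - (∑ n ∈ Finset.Icc 1 x, (if p ∣ n then f n else 0)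
            - f p * ∑ m ∈ Finset.Icc 1 (x / p), f m) := by
          rw [hbp, hD]; field_simp; ring
        have e2 : (x : ℝ) * ‖D p x‖ = ‖(x : ℂ) * D p x‖ := by
          rw [norm_mul, Complex.norm_natCast]
        rw [e2, e1]
        exact (norm_sub_le _ _).trans (by gcongr)
      have h3 : ‖D p x‖ ≤ ‖b p‖ / x + 2 / p ^ 2 := by
        rw [← mul_le_mul_iff_right₀ hx0]
        refine h2.trans (le_of_eq ?_)
        field_simp
      have h4 : ‖D p x‖ ^ 2 ≤ 2 * (‖b p‖ / x) ^ 2 + 2 * (2 / (p : ℝ) ^ 2) ^ 2 := by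
        have := pow_le_pow_left₀ (norm_nonneg _) h3 2
        nlinarith [sq_nonneg (‖b p‖ / x - 2 / (p : ℝ) ^ 2)]
      calc (p : ℝ) * ‖D p x‖ ^ 2 ≤ p * (2 * (‖b p‖ / x) ^ 2 + 2 * (2 / (p : ℝ) ^ 2) ^ 2) := by
            gcongr
        _ = _ := by field_simp; ring
    refine (Finset.sum_le_sum hterm).trans ?_
    rw [Finset.sum_add_distrib, ← Finset.mul_sum, ← Finset.mul_sum]
    have h5 : 2 / (x : ℝ) ^ 2 * ∑ p ∈ P, p * ‖b p‖ ^ 2 ≤ 4 := by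
      calc _ ≤ 2 / (x : ℝ) ^ 2 * (2 * x * x) := by
            gcongr
            exact hdual.trans (by gcongr)
        _ = 4 := by field_simp; norm_num
    have h6 : ∑ p ∈ P, ((p : ℝ) ^ 3)⁻¹ ≤ K := hKs.sum_le_tsum P fun n _ => by positivity
    linarith
  have hlim : ∀ p : ℕ, p.Prime → Filter.Tendsto (fun x => (p : ℝ) * ‖D p x‖ ^ 2) Filter.atTop
      (nhds (‖M‖ ^ 2 * (‖f p - 1‖ ^ 2 / p))) := by
    intro p hp
    have hp0 : (p : ℝ) ≠ 0 := by exact_mod_cast hp.ne_zero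
    have h1 := ((tendsto_sum_natDiv hmean hp.pos).const_mul (f p)).sub
      (hmean.const_mul (1 / (p : ℂ)))
    have h2 := (h1.norm.pow 2).const_mul (p : ℝ)
    have e : (p : ℝ) * ‖f p * (M * (1 / p)) - 1 / (p : ℂ) * M‖ ^ 2
        = ‖M‖ ^ 2 * (‖f p - 1‖ ^ 2 / p) := by
      have : f p * (M * (1 / p)) - 1 / (p : ℂ) * M = M * (f p - 1) * (1 / p) := by ring
      rw [this, norm_mul, norm_mul, norm_div, norm_one, Complex.norm_natCast]
      field_simp
    rw [e] at h2
    refine h2.congr fun x => ?_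
    rw [hD]
    simp only [mul_div_assoc]
  have hbound : ∀ P : Finset ℕ, (∀ p ∈ P, p.Prime) →
      ∑ p ∈ P, ‖f p - 1‖ ^ 2 / (p : ℝ) ≤ (4 + 8 * K) / ‖M‖ ^ 2 := by
    intro P hP
    rw [le_div_iff₀ (by positivity), mul_comm, Finset.mul_sum]
    exact le_of_tendsto (tendsto_finsetSum P fun p hp => hlim p (hP p hp)) (key P hP)
  refine summable_of_sum_le (fun p => by positivity) (c := (4 + 8 * K) / ‖M‖ ^ 2) fun u => ?_
  have := hbound (u.map ⟨fun p : Nat.Primes => (p : ℕ), Subtype.val_injective⟩) (by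
    intro p hp
    obtain ⟨q, -, rfl⟩ := Finset.mem_map.1 hp
    exact q.2)
  rwa [Finset.sum_map] at this

lemma exists_prime_tail_le {c : ℕ → ℝ}
    (hs : Summable (fun p : Nat.Primes => c p)) {ε : ℝ} (hε : 0 < ε) :
    ∃ Y : ℕ, ∀ y, Y ≤ y → ∀ x, ∑ p ∈ (Finset.Ioc y x).filter Nat.Prime, c p ≤ ε := by
  have hs' : Summable ({p : ℕ | p.Prime}.indicator c) :=
    (summable_subtype_iff_indicator (f := c) (s := {p : ℕ | p.Prime})).1 hs
  obtain ⟨s, hs⟩ := summable_iff_vanishing_norm.1 hs' ε hε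
  refine ⟨s.sup id, fun y hy x => ?_⟩
  have h1 := hs (Finset.Ioc y x) (by
    rw [Finset.disjoint_left]
    intro a ha has
    have := Finset.le_sup (f := id) has
    rw [Finset.mem_Ioc] at ha
    simp only [id] at this
    omega)
  refine le_trans (le_of_eq ?_) ((le_abs_self _).trans h1.le)
  rw [Finset.sum_filter]
  exact Finset.sum_congr rfl fun p _ => by simp [Set.indicator_apply]

lemma exists_smooth_approx {f : ℕ → ℂ}
    (hmul : ∀ m n : ℕ, Nat.Coprime m n → f (m * n) = f m * f n)
    (hb : ∀ n, ‖f n‖ ≤ 1) (h1 : f 1 = 1)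
    (hs : Summable (fun p : Nat.Primes => ‖f (p : ℕ) - 1‖ ^ 2 / ((p : ℕ) : ℝ)))
    {δ : ℝ} (hδ : 0 < δ) :
    ∃ Y : ℕ, ∀ y, Y ≤ y → ∀ x, ∑ n ∈ Finset.Icc 1 x,
        ‖f n - f (Nat.gcd n (smoothModulus y)) * Complex.exp (primeSum f y (Nat.sqrt x))‖ ^ 2
      ≤ x * δ := by
  obtain ⟨Y, hY⟩ := exists_prime_tail_le (c := fun p => ‖f p - 1‖ ^ 2 / (p : ℝ))
    hs (show 0 < δ / 42 by positivity)
  obtain ⟨N, hN⟩ := exists_nat_gt (8 / δ)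
  refine ⟨max Y (N + 1), fun y hy x => ?_⟩
  have hy1 : 1 ≤ y := by have := le_max_right Y (N + 1); omega
  refine (sum_norm_sub_smooth_mul_exp_sq_le hmul hb h1 x y hy1).trans ?_
  have h2 := hY y ((le_max_left _ _).trans hy) x
  have hNy : (N : ℝ) ≤ y := by
    have := le_max_right Y (N + 1)
    exact_mod_cast (by omega : N ≤ y)
  have hy0 : (0 : ℝ) < y := by exact_mod_cast hy1
  have h3 : 4 / (y : ℝ) ≤ δ / 2 := by
    rw [div_lt_iff₀ hδ] at hN
    rw [div_le_iff₀ hy0]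
    nlinarith
  gcongr
  linarith

/-- The partial sums of a periodic function have a mean value. -/
lemma exists_mean_of_periodic {g : ℕ → ℂ} {Q : ℕ} (hQ : 0 < Q) (hg : ∀ n, g (n + Q) = g n) :
    ∃ m : ℂ, Filter.Tendsto (fun x : ℕ => (∑ n ∈ Finset.Icc 1 x, g n) / (x : ℂ))
      Filter.atTop (nhds m) := by
  set c := ∑ n ∈ Finset.range Q, g (n + 1)
  set r : ℕ → ℂ := fun x => ∑ n ∈ Finset.range x, g (n + 1) - x * (c / Q) with hr
  have hQ0 : (Q : ℂ) ≠ 0 := by exact_mod_cast hQ.ne'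
  have hrp : Function.Periodic r Q := by
    intro x
    have : ∑ n ∈ Finset.range (x + Q), g (n + 1) = c + ∑ n ∈ Finset.range x, g (n + 1) := by
      rw [add_comm x Q, Finset.sum_range_add]
      congr 1
      refine Finset.sum_congr rfl fun n _ => ?_
      rw [← hg (n + 1)]; congr 1; ring
    simp only [hr]
    rw [this]; push_cast; field_simp; ring
  have hbd : ∀ x, ‖r x‖ ≤ ∑ i ∈ Finset.range Q, ‖r i‖ := fun x => by
    rw [← hrp.map_mod_nat x]
    exact Finset.single_le_sum (f := fun i => ‖r i‖) (fun i _ => norm_nonneg _)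
      (Finset.mem_range.2 (Nat.mod_lt x hQ))
  refine ⟨c / Q, ?_⟩
  have h0 : Filter.Tendsto (fun x : ℕ => r x / (x : ℂ)) Filter.atTop (nhds 0) := by
    refine squeeze_zero_norm (a := fun x : ℕ => (∑ i ∈ Finset.range Q, ‖r i‖) / x) (fun x => ?_)
      (tendsto_const_div_atTop_nhds_zero_nat _)
    rw [norm_div, Complex.norm_natCast]
    exact div_le_div_of_nonneg_right (hbd x) (Nat.cast_nonneg x)
  have h1 := h0.add_const (c / Q)
  rw [zero_add] at h1
  refine h1.congr' ?_
  filter_upwards [Filter.eventually_gt_atTop 0] with x hx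
  have hx0 : (x : ℂ) ≠ 0 := by exact_mod_cast hx.ne'
  have e : ∑ n ∈ Finset.Icc 1 x, g n = ∑ n ∈ Finset.range x, g (n + 1) := by
    rw [Finset.range_eq_Ico, Finset.sum_Ico_add' g 0 x 1]
    refine Finset.sum_congr ?_ fun _ _ => rfl
    ext n
    simp only [Finset.mem_Icc, Finset.mem_Ico]
    omega
  rw [e]
  simp only [hr]
  field_simp
  ring

/-- A sequence with vanishing increments converges if its exponential converges in `ℂˣ`. -/
lemma exists_tendsto_of_tendsto_exp {A : ℕ → ℂ} {L : ℂ} (hL : L ≠ 0)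
    (hexp : Filter.Tendsto (fun z => Complex.exp (A z)) Filter.atTop (nhds L))
    (hinc : Filter.Tendsto (fun z => A (z + 1) - A z) Filter.atTop (nhds 0)) :
    ∃ l : ℂ, Filter.Tendsto A Filter.atTop (nhds l) := by
  set B : ℕ → ℂ := fun z => A z - Complex.log L with hB
  have hBexp : Filter.Tendsto (fun z => Complex.exp (B z)) Filter.atTop (nhds 1) := by
    have := hexp.div_const L
    rw [div_self hL] at this
    refine this.congr fun z => ?_
    rw [hB, Complex.exp_sub, Complex.exp_log hL]
  have hlog : Filter.Tendsto (fun z => Complex.log (Complex.exp (B z))) Filter.atTop (nhds 0) := by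
    have := (continuousAt_clog (x := 1) Complex.one_mem_slitPlane).tendsto.comp hBexp
    rwa [Complex.log_one] at this
  have hk : ∀ z, ∃ k : ℤ,
      B z = Complex.log (Complex.exp (B z)) + k * (2 * Real.pi * Complex.I) := fun z =>
    Complex.exp_eq_exp_iff_exists_int.1 (Complex.exp_log (Complex.exp_ne_zero _)).symm
  choose k hk using hk
  have hdiff : Filter.Tendsto (fun z => ((k (z + 1) - k z : ℤ) : ℂ) * (2 * Real.pi * Complex.I))
      Filter.atTop (nhds 0) := by
    have h1 := hinc.sub ((hlog.comp (Filter.tendsto_add_atTop_nat 1)).sub hlog)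
    rw [sub_zero, sub_zero] at h1
    refine h1.congr fun z => ?_
    have e1 := hk z
    have e2 := hk (z + 1)
    have e3 : A (z + 1) - A z = B (z + 1) - B z := by rw [hB]; ring
    simp only [Function.comp]
    push_cast
    rw [e3]
    linear_combination e2 - e1
  have hev : ∀ᶠ z in Filter.atTop, k (z + 1) = k z := by
    have := (Metric.tendsto_atTop.1 hdiff) 1 one_pos
    obtain ⟨N, hN⟩ := this
    filter_upwards [Filter.eventually_ge_atTop N] with z hz
    have h2 := hN z hz
    rw [dist_zero_right, norm_mul, Complex.norm_intCast] at h2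
    have h3 : ‖(2 * Real.pi * Complex.I : ℂ)‖ = 2 * Real.pi := by
      simp [abs_of_pos Real.pi_pos]
    rw [h3] at h2
    have h4 : |((k (z + 1) - k z : ℤ) : ℝ)| < 1 := by
      nlinarith [Real.pi_gt_three, abs_nonneg (((k (z + 1) - k z : ℤ) : ℝ))]
    have h5 : |k (z + 1) - k z| < 1 := by exact_mod_cast h4
    rw [Int.abs_lt_one_iff] at h5
    omega
  obtain ⟨N, hN⟩ := Filter.eventually_atTop.1 hev
  have hconst : ∀ z, N ≤ z → k z = k N := fun z hz =>
    Nat.le_induction rfl (fun z hz ih => (hN z hz).trans ih) z hz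
  refine ⟨0 + k N * (2 * Real.pi * Complex.I) + Complex.log L, ?_⟩
  refine ((hlog.add_const _).add_const _).congr' ?_
  filter_upwards [Filter.eventually_ge_atTop N] with z hz
  have := hk z
  rw [hconst z hz] at this
  rw [← this, hB]; ring

lemma primeSum_zero_eq {f : ℕ → ℂ} {y z : ℕ} (h : y ≤ z) :
    primeSum f 0 z = primeSum f 0 y + primeSum f y z := by
  unfold primeSum
  rw [Finset.sum_filter, Finset.sum_filter, Finset.sum_filter,
    Finset.sum_Ioc_consecutive _ (Nat.zero_le y) h]

lemma tendsto_primeSum_increment {f : ℕ → ℂ} (hb : ∀ n, ‖f n‖ ≤ 1) :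
    Filter.Tendsto (fun z => primeSum f 0 (z + 1) - primeSum f 0 z) Filter.atTop (nhds 0) := by
  have h0 : Filter.Tendsto (fun z : ℕ => 2 * (1 / ((z : ℝ) + 1))) Filter.atTop (nhds 0) := by
    have := (tendsto_one_div_add_atTop_nhds_zero_nat (𝕜 := ℝ)).const_mul 2
    rwa [mul_zero] at this
  refine squeeze_zero_norm (fun z => ?_) h0
  rw [primeSum_zero_eq (Nat.le_succ z), add_sub_cancel_left, primeSum]
  refine (norm_sum_le _ _).trans ?_
  refine (Finset.sum_le_sum_of_subset_of_nonneg (Finset.filter_subset _ _)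
    fun _ _ _ => norm_nonneg _).trans ?_
  rw [Nat.succ_eq_add_one, Nat.Ioc_succ_singleton, Finset.sum_singleton, norm_div,
    Complex.norm_natCast, div_eq_mul_one_div]
  push_cast
  gcongr
  exact norm_sub_le_two (hb _) (by simp)

lemma norm_mean_sub_exp_mul_mean_le {f g : ℕ → ℂ} {E : ℂ} {x : ℕ} (hx : 0 < x) {η : ℝ}
    (hη : 0 ≤ η) (h : ∑ n ∈ Finset.Icc 1 x, ‖f n - g n * E‖ ^ 2 ≤ x * η ^ 2) :
    ‖(∑ n ∈ Finset.Icc 1 x, f n) / (x : ℂ) - E * ((∑ n ∈ Finset.Icc 1 x, g n) / (x : ℂ))‖ ≤ η := by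
  have hx0 : (0 : ℝ) < x := by exact_mod_cast hx
  have e : (∑ n ∈ Finset.Icc 1 x, f n) / (x : ℂ) - E * ((∑ n ∈ Finset.Icc 1 x, g n) / (x : ℂ))
      = (∑ n ∈ Finset.Icc 1 x, (f n - g n * E)) / x := by
    rw [Finset.sum_sub_distrib, ← Finset.sum_mul]; ring
  rw [e, norm_div, Complex.norm_natCast, div_le_iff₀ hx0]
  refine (norm_sum_le _ _).trans ?_
  have h1 := sq_sum_le_card_mul_sum_sq (s := Finset.Icc 1 x) (f := fun n => ‖f n - g n * E‖)
  rw [Nat.card_Icc, Nat.add_sub_cancel] at h1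
  refine le_of_pow_le_pow_left₀ two_ne_zero (by positivity) ?_
  calc _ ≤ (x : ℝ) * ∑ n ∈ Finset.Icc 1 x, ‖f n - g n * E‖ ^ 2 := h1
    _ ≤ x * (x * η ^ 2) := by gcongr
    _ = _ := by ring

lemma norm_mean_le_one {g : ℕ → ℂ} (hg : ∀ n, ‖g n‖ ≤ 1) (x : ℕ) :
    ‖(∑ n ∈ Finset.Icc 1 x, g n) / (x : ℂ)‖ ≤ 1 := by
  rw [norm_div, Complex.norm_natCast]
  refine div_le_one_of_le₀ ((norm_sum_le _ _).trans ?_) (Nat.cast_nonneg x)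
  calc _ ≤ ∑ n ∈ Finset.Icc 1 x, (1 : ℝ) := Finset.sum_le_sum fun n _ => hg n
    _ = x := by simp

lemma exists_approx_mean {f : ℕ → ℂ}
    (hmul : ∀ m n : ℕ, Nat.Coprime m n → f (m * n) = f m * f n)
    (hb : ∀ n, ‖f n‖ ≤ 1) (h1 : f 1 = 1) {M : ℂ}
    (hmean : Filter.Tendsto (fun x : ℕ => (∑ n ∈ Finset.Icc 1 x, f n) / (x : ℂ))
      Filter.atTop (nhds M))
    (hs : Summable (fun p : Nat.Primes => ‖f (p : ℕ) - 1‖ ^ 2 / ((p : ℕ) : ℝ)))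
    {η : ℝ} (hη : 0 < η) :
    ∃ y : ℕ, ∃ m : ℂ, ‖m‖ ≤ 1 ∧ ∀ᶠ z in Filter.atTop,
      ‖M - Complex.exp (primeSum f y z) * m‖ ≤ 3 * η := by
  obtain ⟨y, hy⟩ := exists_smooth_approx hmul hb h1 hs (sq_pos_of_pos hη)
  have hy := hy y le_rfl
  set g : ℕ → ℂ := fun n => f (Nat.gcd n (smoothModulus y)) with hg
  obtain ⟨m, hm⟩ := exists_mean_of_periodic (g := g) (smoothModulus_pos y)
    (fun n => by simp only [hg, Nat.gcd_add_self_left])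
  refine ⟨y, m, le_of_tendsto hm.norm (Filter.Eventually.of_forall
    fun x => norm_mean_le_one (fun n => hb _) x), ?_⟩
  have hzz : Filter.Tendsto (fun z : ℕ => z * z) Filter.atTop Filter.atTop :=
    Filter.tendsto_id.atTop_mul_atTop₀ Filter.tendsto_id
  have t1 := (Metric.tendsto_nhds.1 (hmean.comp hzz)) η hη
  have t2 := (Metric.tendsto_nhds.1 (hm.comp hzz)) η hη
  filter_upwards [t1, t2, Filter.eventually_gt_atTop 0] with z h2 h3 hz
  have h4 := norm_mean_sub_exp_mul_mean_le (Nat.mul_pos hz hz) hη.le (hy (z * z))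
  rw [Nat.sqrt_eq] at h4
  simp only [Function.comp, dist_eq_norm] at h2 h3
  set E := Complex.exp (primeSum f y z)
  set F := (∑ n ∈ Finset.Icc 1 (z * z), f n) / ((z * z : ℕ) : ℂ)
  set G := (∑ n ∈ Finset.Icc 1 (z * z), g n) / ((z * z : ℕ) : ℂ)
  have hE : ‖E‖ ≤ 1 := norm_exp_le_one (primeSum_re_nonpos hb y z)
  have e : M - E * m = -(F - M) + (F - E * G) + E * (G - m) := by ring
  rw [e]
  have h5 : ‖E * (G - m)‖ ≤ η := by
    rw [norm_mul]
    exact (mul_le_of_le_one_left (norm_nonneg _) hE).trans h3.le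
  refine norm_add₃_le.trans ?_
  rw [norm_neg]
  linarith

/-- A nonzero mean value forces convergence of the linear series over primes. -/
lemma exists_tendsto_primeSum {f : ℕ → ℂ}
    (hmul : ∀ m n : ℕ, Nat.Coprime m n → f (m * n) = f m * f n)
    (hb : ∀ n, ‖f n‖ ≤ 1) (h1 : f 1 = 1) {M : ℂ} (hM : M ≠ 0)
    (hmean : Filter.Tendsto (fun x : ℕ => (∑ n ∈ Finset.Icc 1 x, f n) / (x : ℂ))
      Filter.atTop (nhds M))
    (hs : Summable (fun p : Nat.Primes => ‖f (p : ℕ) - 1‖ ^ 2 / ((p : ℕ) : ℝ))) :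
    ∃ l : ℂ, Filter.Tendsto (primeSum f 0) Filter.atTop (nhds l) := by
  have hM0 : 0 < ‖M‖ := norm_pos_iff.2 hM
  have hlow : ∀ {E m : ℂ} {η : ℝ}, ‖M - E * m‖ ≤ 3 * η → 3 * η ≤ ‖M‖ / 2 →
      ‖M‖ / 2 ≤ ‖E‖ * ‖m‖ := fun {E m η} h h' => by
    have := norm_sub_norm_le M (E * m)
    rw [norm_mul] at this
    linarith
  have hcauchy : CauchySeq fun z => Complex.exp (primeSum f 0 z) := by
    rw [Metric.cauchySeq_iff]
    intro ε hε
    set η := min (‖M‖ / 6) (ε * ‖M‖ / 24) with hη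
    have hη0 : 0 < η := lt_min (by positivity) (by positivity)
    have hη1 : 3 * η ≤ ‖M‖ / 2 := by
      have := min_le_left (‖M‖ / 6) (ε * ‖M‖ / 24)
      linarith
    have hη2 : 24 * η ≤ ε * ‖M‖ := by
      have := min_le_right (‖M‖ / 6) (ε * ‖M‖ / 24)
      linarith
    obtain ⟨y, m, hm, hev⟩ := exists_approx_mean hmul hb h1 hmean hs hη0
    obtain ⟨N, hN⟩ := Filter.eventually_atTop.1 hev
    refine ⟨max N y, fun a ha b hb' => ?_⟩
    have ha1 := hN a ((le_max_left _ _).trans ha)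
    have hb1 := hN b ((le_max_left _ _).trans hb')
    rw [dist_eq_norm, primeSum_zero_eq ((le_max_right N y).trans ha),
      primeSum_zero_eq ((le_max_right N y).trans hb'), Complex.exp_add, Complex.exp_add,
      ← mul_sub, norm_mul]
    refine (mul_le_of_le_one_left (norm_nonneg _)
      (norm_exp_le_one (primeSum_re_nonpos hb 0 y))).trans_lt ?_
    have hEa : ‖Complex.exp (primeSum f y a)‖ ≤ 1 := norm_exp_le_one (primeSum_re_nonpos hb y a)
    have hl := hlow ha1 hη1
    set Ea := Complex.exp (primeSum f y a)
    set Eb := Complex.exp (primeSum f y b)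
    have hmlow : ‖M‖ / 2 ≤ ‖m‖ := hl.trans (mul_le_of_le_one_left (norm_nonneg _) hEa)
    have h6 : ‖Ea - Eb‖ * ‖m‖ ≤ 6 * η := by
      have e : (Ea - Eb) * m = (M - Eb * m) - (M - Ea * m) := by ring
      rw [← norm_mul, e]
      exact (norm_sub_le _ _).trans (by linarith)
    have h7 : ‖Ea - Eb‖ * (‖M‖ / 2) ≤ ‖Ea - Eb‖ * ‖m‖ := by gcongr
    have h8 : ‖Ea - Eb‖ * ‖M‖ < ε * ‖M‖ := by linarith
    exact lt_of_mul_lt_mul_right h8 hM0.le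
  obtain ⟨L, hL⟩ := cauchySeq_tendsto_of_complete hcauchy
  refine exists_tendsto_of_tendsto_exp ?_ hL (tendsto_primeSum_increment hb)
  obtain ⟨y, m, hm, hev⟩ := exists_approx_mean hmul hb h1 hmean hs
    (show 0 < ‖M‖ / 6 by positivity)
  have hbelow : ∀ᶠ z in Filter.atTop,
      ‖Complex.exp (primeSum f 0 y)‖ * (‖M‖ / 2) ≤ ‖Complex.exp (primeSum f 0 z)‖ := by
    filter_upwards [hev, Filter.eventually_ge_atTop y] with z hz hyz
    rw [primeSum_zero_eq hyz, Complex.exp_add, norm_mul]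
    gcongr
    refine (hlow hz (by linarith)).trans ?_
    exact mul_le_of_le_one_right (norm_nonneg _) hm
  have := ge_of_tendsto hL.norm hbelow
  refine norm_pos_iff.1 (lt_of_lt_of_le ?_ this)
  have : 0 < ‖Complex.exp (primeSum f 0 y)‖ := norm_pos_iff.2 (Complex.exp_ne_zero _)
  positivity

lemma seminorm2_lt {h : ℕ → ℂ} {ε : ℝ} (hε : 0 < ε)
    (hev : ∀ᶠ x : ℕ in Filter.atTop,
      (∑ n ∈ Finset.Icc 1 x, ‖h n‖ ^ 2) / (x : ℝ) ≤ ε ^ 2 / 2) :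
    seminorm2 h < ε := by
  unfold seminorm2
  rw [Real.sqrt_lt' hε]
  have hco : Filter.IsCoboundedUnder (· ≤ ·) Filter.atTop
      (fun x : ℕ => (∑ n ∈ Finset.Icc 1 x, ‖h n‖ ^ 2) / (x : ℝ)) :=
    (Filter.isBoundedUnder_of ⟨0, fun x => by positivity⟩ :
      Filter.IsBoundedUnder (· ≥ ·) _ _).isCoboundedUnder_le
  refine (Filter.limsup_le_of_le hco hev).trans_lt ?_
  have := sq_pos_of_pos hε
  linarith

/-- Convergence of both prime series makes `f` a mean square limit of periodic functions. -/
lemma memB2_of_tendsto_primeSum {f : ℕ → ℂ}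
    (hmul : ∀ m n : ℕ, Nat.Coprime m n → f (m * n) = f m * f n)
    (hb : ∀ n, ‖f n‖ ≤ 1) (h1 : f 1 = 1)
    (hs : Summable (fun p : Nat.Primes => ‖f (p : ℕ) - 1‖ ^ 2 / ((p : ℕ) : ℝ)))
    {l : ℂ} (hl : Filter.Tendsto (primeSum f 0) Filter.atTop (nhds l)) : MemB2 f := by
  intro ε hε
  obtain ⟨Y, hY⟩ := exists_smooth_approx hmul hb h1 hs (show 0 < ε ^ 2 / 8 by positivity)
  obtain ⟨N, hN⟩ := Metric.cauchySeq_iff.1 hl.cauchySeq (ε / 4) (by positivity)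
  set y := max Y N with hy
  have hapx := hY y (le_max_left _ _)
  set g : ℕ → ℂ := fun n => f (Nat.gcd n (smoothModulus y)) with hg
  refine ⟨g, ⟨smoothModulus y, smoothModulus_pos y,
    fun n => by simp only [hg, Nat.gcd_add_self_left]⟩, seminorm2_lt hε ?_⟩
  filter_upwards [Filter.eventually_ge_atTop (y * y + 1)] with x hx
  have hx0 : (0 : ℝ) < x := by
    have : 0 < x := by omega
    exact_mod_cast this
  have hyx : y ≤ Nat.sqrt x := Nat.le_sqrt.2 (by omega)
  have hsmall : ‖primeSum f y (Nat.sqrt x)‖ ≤ ε / 4 := by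
    have h2 := hN (Nat.sqrt x) ((le_max_right Y N).trans hyx) y (le_max_right Y N)
    rw [dist_eq_norm, primeSum_zero_eq hyx, add_sub_cancel_left] at h2
    exact h2.le
  have hE : ‖Complex.exp (primeSum f y (Nat.sqrt x)) - 1‖ ≤ ε / 4 := by
    have := norm_exp_sub_exp_le (v := 0) (le_refl 0) (primeSum_re_nonpos hb y (Nat.sqrt x))
    rw [Complex.exp_zero, sub_zero] at this
    exact this.trans hsmall
  set E := Complex.exp (primeSum f y (Nat.sqrt x))
  have hpt : ∀ n ∈ Finset.Icc 1 x,
      ‖f n - g n‖ ^ 2 ≤ 2 * ‖f n - g n * E‖ ^ 2 + 2 * (ε / 4) ^ 2 := by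
    intro n _
    have e : f n - g n = (f n - g n * E) + g n * (E - 1) := by ring
    have h3 : ‖g n * (E - 1)‖ ≤ ε / 4 := by
      rw [norm_mul]
      exact (mul_le_of_le_one_left (norm_nonneg _) (hb _)).trans hE
    have h4 : ‖f n - g n‖ ≤ ‖f n - g n * E‖ + ε / 4 := by
      rw [e]; exact (norm_add_le _ _).trans (by gcongr)
    have h5 := pow_le_pow_left₀ (norm_nonneg _) h4 2
    nlinarith [sq_nonneg (‖f n - g n * E‖ - ε / 4)]
  rw [div_le_iff₀ hx0]
  refine (Finset.sum_le_sum hpt).trans ?_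
  rw [Finset.sum_add_distrib, ← Finset.mul_sum, Finset.sum_const, Nat.card_Icc,
    Nat.add_sub_cancel, nsmul_eq_mul]
  have := hapx x
  nlinarith [mul_pos hx0 (sq_pos_of_pos hε)]

/-- a multiplicative function with `|f| ≤ 1` and nonzero mean value lies in
`B²` iff `S₁ = ∑_p (f(p)-1)/p` and `S₂ = ∑_p |f(p)-1|²/p` converge. -/
theorem stmt_10 (f : ℕ → ℂ)
    (hmul : ∀ m n : ℕ, Nat.Coprime m n → f (m * n) = f m * f n)
    (hb : ∀ n, ‖f n‖ ≤ 1) (M : ℂ) (hM : M ≠ 0)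
    (hmean : Filter.Tendsto (fun x : ℕ => (∑ n ∈ Finset.Icc 1 x, f n) / (x : ℂ))
      Filter.atTop (nhds M)) :
    MemB2 f ↔
      ((∃ L : ℂ, Filter.Tendsto (fun x : ℕ =>
            ∑ p ∈ (Finset.range (x + 1)).filter Nat.Prime, (f p - 1) / (p : ℂ))
          Filter.atTop (nhds L)) ∧
       Summable (fun p : Nat.Primes => ‖f (p : ℕ) - 1‖ ^ 2 / ((p : ℕ) : ℝ))) := by
  have h1 : f 1 = 1 := by
    by_contra h
    refine hM (tendsto_nhds_unique hmean (tendsto_const_nhds.congr fun x => ?_))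
    have hz : ∀ n, f n = 0 := fun n => by
      by_contra hn
      exact h (map_one_of_multiplicative hmul hn)
    simp [hz]
  have hs := summable_of_mean_ne_zero hmul hb hM hmean
  obtain ⟨l, hl⟩ := exists_tendsto_primeSum hmul hb h1 hM hmean hs
  refine iff_of_true (memB2_of_tendsto_primeSum hmul hb h1 hs hl) ⟨⟨l, ?_⟩, hs⟩
  refine hl.congr fun x => ?_
  unfold primeSum
  refine Finset.sum_congr ?_ fun _ _ => rfl
  ext p
  simp only [Finset.mem_filter, Finset.mem_Ioc, Finset.mem_range]
  constructor
  · rintro ⟨⟨-, h⟩, hp⟩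
    exact ⟨by omega, hp⟩
  · rintro ⟨h, hp⟩
    exact ⟨⟨hp.pos, by omega⟩, hp⟩
end

section
/- For every positive integer k, there exists a positive integer a with ⌊√2·a⌋ = k if and only if ⌊(k+1)/√2⌋ − ⌊k/√2⌋ = 1. -/
open MeasureTheory Filter Finset
open scoped Classical

/-- A positive natural number is not an integer multiple of `√2`. -/
lemma sqrt_two_mul_intCast_ne_natCast (m : ℕ) (hm : 0 < m) (n : ℤ) :
    Real.sqrt 2 * (n : ℝ) ≠ (m : ℝ) := by
  intro h
  have hn : n ≠ 0 := by
    rintro rfl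
    have : (m : ℝ) = 0 := by simpa using h.symm
    exact hm.ne' (by exact_mod_cast this)
  exact (irrational_sqrt_two.mul_intCast hn).ne_nat m h

/-- for a positive integer `k`, there exists a positive integer `a` with
`⌊√2·a⌋ = k` iff `⌊(k+1)/√2⌋ - ⌊k/√2⌋ = 1`. -/
theorem stmt_14 (k : ℕ) (hk : 0 < k) :
    (∃ a : ℕ, 0 < a ∧ ⌊Real.sqrt 2 * (a : ℝ)⌋ = (k : ℤ)) ↔
    ⌊((k : ℝ) + 1) / Real.sqrt 2⌋ - ⌊(k : ℝ) / Real.sqrt 2⌋ = 1 := by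
  have h0 : (0 : ℝ) < Real.sqrt 2 := by positivity
  have h1 : (1 : ℝ) < Real.sqrt 2 := Real.one_lt_sqrt_two
  have hstep : ((k : ℝ) + 1) / Real.sqrt 2 < (k : ℝ) / Real.sqrt 2 + 1 := by
    rw [add_div]
    have : 1 / Real.sqrt 2 < 1 := (div_lt_one h0).2 h1
    linarith
  constructor
  · rintro ⟨a, -, ha⟩
    obtain ⟨hl, hu⟩ := Int.floor_eq_iff.1 ha
    push_cast at hl hu
    have hne := sqrt_two_mul_intCast_ne_natCast k hk a
    push_cast at hne
    have hlow : (k : ℝ) / Real.sqrt 2 < a :=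
      (div_lt_iff₀' h0).2 (lt_of_le_of_ne hl hne.symm)
    have hupp : (a : ℝ) < ((k : ℝ) + 1) / Real.sqrt 2 := (lt_div_iff₀' h0).2 hu
    have e1 : ⌊((k : ℝ) + 1) / Real.sqrt 2⌋ = (a : ℤ) := by
      rw [Int.floor_eq_iff]
      push_cast
      constructor <;> linarith
    have e2 : ⌊(k : ℝ) / Real.sqrt 2⌋ = (a : ℤ) - 1 := by
      rw [Int.floor_eq_iff]
      push_cast
      constructor <;> linarith
    rw [e1, e2]
    ring
  · intro h
    have hnonneg : 0 ≤ ⌊(k : ℝ) / Real.sqrt 2⌋ := Int.floor_nonneg.2 (by positivity)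
    obtain ⟨a, ha⟩ : ∃ a : ℕ, ⌊((k : ℝ) + 1) / Real.sqrt 2⌋ = (a : ℤ) :=
      Int.eq_ofNat_of_zero_le (by omega)
    have hupp := (Int.floor_eq_iff.1 ha).1
    have hlow := Int.lt_floor_add_one ((k : ℝ) / Real.sqrt 2)
    have hk' : ⌊(k : ℝ) / Real.sqrt 2⌋ = (a : ℤ) - 1 := by omega
    rw [hk'] at hlow
    push_cast at hlow hupp
    rw [sub_add_cancel, div_lt_iff₀' h0] at hlow
    rw [le_div_iff₀' h0] at hupp
    have hne := sqrt_two_mul_intCast_ne_natCast (k + 1) k.succ_pos a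
    push_cast at hne
    refine ⟨a, by omega, Int.floor_eq_iff.2 ?_⟩
    push_cast
    exact ⟨hlow.le, lt_of_le_of_ne hupp hne⟩
end

section
/- Let θ > 1 be irrational (e.g. θ = √2 or θ = √3) and let f be the characteristic function of the set {k ∈ ℕ : ∃ a ∈ ℕ₊, ⌊θ·a⌋ = k}. Then f belongs to A², and spec(f) is contained in the set {k/θ mod 1 : k ∈ ℤ}. -/
open MeasureTheory Filter Finset
open scoped Classical

theorem e_add (s t : ℝ) : e (s + t) = e s * e t := by
  rw [e, e, e, ← Complex.exp_add]
  push_cast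
  ring_nf

theorem norm_e (t : ℝ) : ‖e t‖ = 1 := by
  rw [e, show (2 * Real.pi * Complex.I * t : ℂ) = ((2 * Real.pi * t : ℝ) : ℂ) * Complex.I by
    push_cast; ring]
  exact Complex.norm_exp_ofReal_mul_I _

theorem e_eq_one_iff (t : ℝ) : e t = 1 ↔ ∃ k : ℤ, t = k := by
  have h2 : (2 * Real.pi * Complex.I : ℂ) ≠ 0 := Complex.two_pi_I_ne_zero
  rw [e, Complex.exp_eq_one_iff]
  refine exists_congr fun k => ?_
  rw [mul_comm (k : ℂ), mul_right_inj' h2]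
  exact_mod_cast Iff.rfl

theorem e_mul_natCast (α : ℝ) (n : ℕ) : e (α * n) = e α ^ n := by
  rw [e, e, ← Complex.exp_nat_mul]
  push_cast
  ring_nf

/-- The mean value of a nontrivial character of `ℤ` is zero. -/
theorem tendsto_mean_e {α : ℝ} (hα : ¬ ∃ k : ℤ, α = k) :
    Tendsto (fun x : ℕ => (∑ n ∈ Icc 1 x, e (α * n)) / (x : ℂ)) atTop (nhds 0) := by
  have hne : e α - 1 ≠ 0 := fun h => hα ((e_eq_one_iff α).1 (sub_eq_zero.1 h))
  have hpos : 0 < ‖e α - 1‖ := norm_pos_iff.2 hne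
  have hsum (x : ℕ) : (e α - 1) * ∑ n ∈ Icc 1 x, e (α * n) = e α ^ (x + 1) - e α := by
    induction x with
    | zero => simp
    | succ x ih =>
      rw [Finset.sum_Icc_succ_top (by omega), mul_add, ih, e_mul_natCast]
      ring
  have hbound (x : ℕ) : ‖∑ n ∈ Icc 1 x, e (α * n)‖ ≤ 2 / ‖e α - 1‖ := by
    rw [le_div_iff₀ hpos, mul_comm, ← norm_mul, hsum]
    refine (norm_sub_le _ _).trans ?_
    rw [norm_pow, norm_e]
    norm_num
  refine squeeze_zero_norm (a := fun x : ℕ => 2 / ‖e α - 1‖ / x) (fun x => ?_)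
    (tendsto_const_div_atTop_nhds_zero_nat _)
  rw [norm_div, Complex.norm_natCast]
  gcongr
  exact hbound x

theorem fourier_coe_eq_e (k : ℤ) (t : ℝ) : fourier k (t : UnitAddCircle) = e (k * t) := by
  rw [fourier_coe_apply, e]
  push_cast
  ring_nf

theorem integral_fourier (k : ℤ) :
    ∫ t : UnitAddCircle, fourier k t ∂AddCircle.haarAddCircle = if k = 0 then 1 else 0 := by
  have h := congrFun (fourierCoeff_fourier (T := (1 : ℝ)) k) 0
  simp only [fourierCoeff, neg_zero, fourier_zero, one_smul] at h
  rw [h, Pi.single_apply]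
  simp [eq_comm]

/-- Weyl's equidistribution theorem, for characters. -/
theorem tendsto_mean_fourier {δ : ℝ} (hδ : Irrational δ) (k : ℤ) :
    Tendsto (fun x : ℕ => (∑ n ∈ Icc 1 x, fourier k ((δ * n : ℝ) : UnitAddCircle)) / (x : ℂ)) atTop
      (nhds (∫ t : UnitAddCircle, fourier k t ∂AddCircle.haarAddCircle)) := by
  rw [integral_fourier]
  split_ifs with hk
  · subst hk
    refine tendsto_const_nhds.congr' ?_
    filter_upwards [eventually_gt_atTop 0] with x hx
    have : (x : ℂ) ≠ 0 := by exact_mod_cast hx.ne'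
    simp [this]
  · simp_rw [fourier_coe_eq_e, ← mul_assoc]
    refine tendsto_mean_e ?_
    rintro ⟨m, hm⟩
    exact (hδ.intCast_mul hk).ne_int m hm

/-- Weyl's equidistribution theorem, for continuous functions. -/
theorem tendsto_mean_continuousMap {δ : ℝ} (hδ : Irrational δ) (h : C(UnitAddCircle, ℂ)) :
    Tendsto (fun x : ℕ => (∑ n ∈ Icc 1 x, h ((δ * n : ℝ) : UnitAddCircle)) / (x : ℂ)) atTop
      (nhds (∫ t : UnitAddCircle, h t ∂AddCircle.haarAddCircle)) := by
  have hint (g : C(UnitAddCircle, ℂ)) : Integrable g AddCircle.haarAddCircle :=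
    g.continuous.integrable_of_hasCompactSupport (HasCompactSupport.of_compactSpace _)
  have hspan : ∀ g ∈ Submodule.span ℂ (Set.range (fourier (T := (1 : ℝ)))),
      Tendsto (fun x : ℕ => (∑ n ∈ Icc 1 x, g ((δ * n : ℝ) : UnitAddCircle)) / (x : ℂ)) atTop
        (nhds (∫ t : UnitAddCircle, g t ∂AddCircle.haarAddCircle)) := by
    intro g hg
    induction hg using Submodule.span_induction with
    | mem g hg =>
      obtain ⟨k, rfl⟩ := hg
      exact tendsto_mean_fourier hδ k
    | zero => simp
    | add f g _ _ hf hg =>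
      simp only [ContinuousMap.add_apply, Finset.sum_add_distrib, add_div]
      rw [integral_add (hint f) (hint g)]
      exact hf.add hg
    | smul a g _ hg =>
      simp only [ContinuousMap.smul_apply, smul_eq_mul, ← Finset.mul_sum, mul_div_assoc]
      rw [integral_const_mul]
      exact hg.const_mul a
  have hmem : h ∈ closure
      (Submodule.span ℂ (Set.range (fourier (T := (1 : ℝ)))) : Set C(UnitAddCircle, ℂ)) := by
    rw [← Submodule.topologicalClosure_coe, span_fourier_closure_eq_top]
    trivial
  rw [Metric.tendsto_atTop']
  intro ε hε
  obtain ⟨g, hg, hgh⟩ := Metric.mem_closure_iff.1 hmem (ε / 3) (by positivity)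
  rw [dist_eq_norm] at hgh
  have hpt (t : UnitAddCircle) : ‖h t - g t‖ ≤ ε / 3 :=
    ((h - g).norm_coe_le_norm t).trans hgh.le
  obtain ⟨N, hN⟩ := Metric.tendsto_atTop'.1 (hspan g hg) (ε / 3) (by positivity)
  refine ⟨N, fun x hx => ?_⟩
  have h1 := hN x hx
  rw [dist_eq_norm] at h1 ⊢
  have hx0 : 0 < (x : ℝ) := by exact_mod_cast (Nat.zero_le N).trans_lt hx
  have h2 : ‖(∑ n ∈ Icc 1 x, h ((δ * n : ℝ) : UnitAddCircle)) / (x : ℂ) -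
      (∑ n ∈ Icc 1 x, g ((δ * n : ℝ) : UnitAddCircle)) / (x : ℂ)‖ ≤ ε / 3 := by
    rw [← sub_div, ← Finset.sum_sub_distrib, norm_div, Complex.norm_natCast, div_le_iff₀ hx0]
    refine (norm_sum_le_of_le _ fun n _ => hpt _).trans ?_
    simp [mul_comm]
  have h3 : ‖(∫ t : UnitAddCircle, g t ∂AddCircle.haarAddCircle) -
      ∫ t : UnitAddCircle, h t ∂AddCircle.haarAddCircle‖ ≤ ε / 3 := by
    rw [← integral_sub (hint g) (hint h)]
    refine (norm_integral_le_of_norm_le_const (C := ε / 3) (ae_of_all _ fun t => ?_)).trans ?_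
    · rw [norm_sub_rev]
      exact hpt t
    · simp
  have key := norm_add₃_le (a := (∑ n ∈ Icc 1 x, h ((δ * n : ℝ) : UnitAddCircle)) / (x : ℂ) -
      (∑ n ∈ Icc 1 x, g ((δ * n : ℝ) : UnitAddCircle)) / (x : ℂ))
    (b := (∑ n ∈ Icc 1 x, g ((δ * n : ℝ) : UnitAddCircle)) / (x : ℂ) -
      ∫ t : UnitAddCircle, g t ∂AddCircle.haarAddCircle)
    (c := (∫ t : UnitAddCircle, g t ∂AddCircle.haarAddCircle) -
      ∫ t : UnitAddCircle, h t ∂AddCircle.haarAddCircle)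
  rw [sub_add_sub_cancel, sub_add_sub_cancel] at key
  linarith

/-- A set of null frontier, sampled along an irrational rotation, is approximated in mean square
by trigonometric polynomials whose frequencies are multiples of the rotation number. -/
theorem exists_trigPoly_approx_indicator {δ : ℝ} (hδ : Irrational δ) {A : Set UnitAddCircle}
    (hA : AddCircle.haarAddCircle (frontier A) = 0) {ε : ℝ} (hε : 0 < ε) :
    ∃ c : ℤ →₀ ℂ, ∀ᶠ x : ℕ in atTop,
      (∑ n ∈ Icc 1 x, ‖A.indicator (fun _ => (1 : ℂ)) ((δ * n : ℝ) : UnitAddCircle) -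
        c.sum (fun k a => a * e (k * δ * n))‖ ^ 2) / x ≤ ε := by
  obtain ⟨U, hU, hUo, hUε⟩ := Set.exists_isOpen_lt_of_lt (μ := AddCircle.haarAddCircle)
    (frontier A) (ENNReal.ofReal (ε / 8)) (by rw [hA]; simpa using hε)
  obtain ⟨φ, hφ0, hφ1, hφ⟩ := exists_continuous_zero_one_of_isClosed
    (isClosed_frontier (s := A)) hUo.isClosed_compl (Set.disjoint_compl_right_iff_subset.2 hU)
  let G : C(UnitAddCircle, ℂ) := ⟨A.indicator (fun t => (φ t : ℂ)), continuous_indicator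
    (fun t ht => by simp [hφ0 ht]) (by fun_prop)⟩
  let B : C(UnitAddCircle, ℂ) := ⟨fun t => ((1 - φ t : ℝ) : ℂ), by fun_prop⟩
  have hBint : ‖∫ t, B t ∂AddCircle.haarAddCircle‖ ≤ ε / 8 := by
    have hle (t : UnitAddCircle) : ‖B t‖ ≤ U.indicator (fun _ => (1 : ℝ)) t := by
      have hn : ‖B t‖ = 1 - φ t := by
        rw [ContinuousMap.coe_mk, Complex.norm_real, Real.norm_eq_abs,
          abs_of_nonneg (sub_nonneg.2 (hφ t).2)]
      rw [hn]
      by_cases ht : t ∈ U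
      · rw [Set.indicator_of_mem ht]
        linarith [(hφ t).1]
      · rw [Set.indicator_of_notMem ht, hφ1 ht]
        simp
    refine (norm_integral_le_of_norm_le
      ((integrable_const (1 : ℝ)).indicator hUo.measurableSet) (ae_of_all _ hle)).trans ?_
    rw [integral_indicator_const _ hUo.measurableSet, smul_eq_mul, mul_one]
    exact ENNReal.toReal_le_of_le_ofReal (by positivity) hUε.le
  have hmem : G ∈ closure
      (Submodule.span ℂ (Set.range (fourier (T := (1 : ℝ)))) : Set C(UnitAddCircle, ℂ)) := by
    rw [← Submodule.topologicalClosure_coe, span_fourier_closure_eq_top]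
    trivial
  obtain ⟨P, hP, hGP⟩ := Metric.mem_closure_iff.1 hmem (√(ε / 4)) (by positivity)
  rw [dist_eq_norm] at hGP
  obtain ⟨c, rfl⟩ := Finsupp.mem_span_range_iff_exists_finsupp.1 hP
  set P : C(UnitAddCircle, ℂ) := c.sum fun k a => a • fourier k with hPdef
  refine ⟨c, ?_⟩
  have hPe (n : ℕ) :
      c.sum (fun k a => a * e (k * δ * n)) = P ((δ * n : ℝ) : UnitAddCircle) := by
    rw [hPdef, Finsupp.sum, Finsupp.sum, ContinuousMap.sum_apply]
    refine Finset.sum_congr rfl fun k _ => ?_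
    rw [ContinuousMap.smul_apply, fourier_coe_eq_e, smul_eq_mul, mul_assoc]
  have hpt (t : UnitAddCircle) :
      ‖A.indicator (fun _ => (1 : ℂ)) t - P t‖ ^ 2 ≤ 2 * (1 - φ t) + ε / 2 := by
    have h1 : ‖A.indicator (fun _ => (1 : ℂ)) t - G t‖ ≤ 1 - φ t := by
      have h0 : 0 ≤ 1 - φ t := sub_nonneg.2 (hφ t).2
      by_cases ht : t ∈ A
      · simp only [G, ContinuousMap.coe_mk, Set.indicator_of_mem ht]
        rw [← Complex.ofReal_one, ← Complex.ofReal_sub, Complex.norm_real, Real.norm_eq_abs,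
          abs_of_nonneg h0]
      · simpa [G, Set.indicator_of_notMem ht] using (hφ t).2
    have h2 : ‖G t - P t‖ ≤ √(ε / 4) := ((G - P).norm_coe_le_norm t).trans hGP.le
    have h3 := norm_add_le (A.indicator (fun _ => (1 : ℂ)) t - G t) (G t - P t)
    rw [sub_add_sub_cancel] at h3
    have h4 : √(ε / 4) ^ 2 = ε / 4 := Real.sq_sqrt (by positivity)
    have h5 : ‖A.indicator (fun _ => (1 : ℂ)) t - P t‖ ^ 2 ≤ ((1 - φ t) + √(ε / 4)) ^ 2 := by
      gcongr
      linarith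
    have h6 := sq_nonneg ((1 - φ t) - √(ε / 4))
    nlinarith [(hφ t).1, (hφ t).2]
  have hmean := (tendsto_mean_continuousMap hδ B).norm.eventually_lt_const
    (hBint.trans_lt (show ε / 8 < ε / 4 by linarith))
  filter_upwards [hmean, eventually_gt_atTop 0] with x hx hx0
  have hx0' : 0 < (x : ℝ) := by exact_mod_cast hx0
  simp only [B, ContinuousMap.coe_mk] at hx
  rw [← Complex.ofReal_sum, norm_div, Complex.norm_natCast, div_lt_iff₀ hx0',
    Complex.norm_real] at hx
  have hx' := (Real.le_norm_self _).trans_lt hx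
  rw [div_le_iff₀ hx0']
  calc _ ≤ ∑ n ∈ Icc 1 x, (2 * (1 - φ ((δ * n : ℝ) : UnitAddCircle)) + ε / 2) :=
        Finset.sum_le_sum fun n _ => by rw [hPe]; exact hpt _
    _ = 2 * ∑ n ∈ Icc 1 x, (1 - φ ((δ * n : ℝ) : UnitAddCircle)) + x * (ε / 2) := by
        rw [Finset.sum_add_distrib, Finset.mul_sum]
        simp
    _ ≤ ε * x := by linarith

theorem frontier_coe_image_Ico_subset (a b : ℝ) :
    frontier ((↑) '' Set.Ico a b : Set UnitAddCircle) ⊆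
      {(a : UnitAddCircle), (b : UnitAddCircle)} := by
  have h1 : closure ((↑) '' Set.Ico a b : Set UnitAddCircle) ⊆ (↑) '' Set.Icc a b :=
    closure_minimal (Set.image_mono Set.Ico_subset_Icc_self)
      (isCompact_Icc.image (AddCircle.continuous_mk' 1)).isClosed
  have h2 : ((↑) '' Set.Ioo a b : Set UnitAddCircle) ⊆ interior ((↑) '' Set.Ico a b) :=
    interior_maximal (Set.image_mono Set.Ioo_subset_Ico_self)
      (QuotientAddGroup.isOpenMap_coe _ isOpen_Ioo)
  rintro t ⟨ht, ht'⟩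
  obtain ⟨y, hy, rfl⟩ := h1 ht
  by_cases hya : y = a
  · simp [hya]
  by_cases hyb : y = b
  · simp [hyb]
  exact absurd (h2 ⟨y, ⟨lt_of_le_of_ne hy.1 (Ne.symm hya), lt_of_le_of_ne hy.2 hyb⟩, rfl⟩) ht'

theorem haar_singleton (t : UnitAddCircle) : AddCircle.haarAddCircle {t} = 0 := by
  have h := AddCircle.volume_closedBall (T := 1) (x := t) 0
  rwa [Metric.closedBall_zero, mul_zero, min_eq_right zero_le_one, ENNReal.ofReal_zero,
    AddCircle.volume_eq_smul_haarAddCircle, ENNReal.ofReal_one, one_smul] at h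

theorem haar_frontier_coe_image_Ico (a b : ℝ) :
    AddCircle.haarAddCircle (frontier ((↑) '' Set.Ico a b : Set UnitAddCircle)) = 0 :=
  measure_mono_null (frontier_coe_image_Ico_subset a b)
    (measure_union_null (haar_singleton _) (haar_singleton _))

/-- The Beatty sequence of `θ` is the set of return times of the rotation by `-1/θ` to an arc. -/
theorem charFun_beatty_eq_indicator {θ : ℝ} (hθ : 1 < θ) {n : ℕ} (hn : 1 ≤ n) :
    charFun {k : ℕ | ∃ a : ℕ, 0 < a ∧ ⌊θ * (a : ℝ)⌋ = (k : ℤ)} n =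
      ((↑) '' Set.Ico 0 θ⁻¹ : Set UnitAddCircle).indicator (fun _ => (1 : ℂ))
        ((-θ⁻¹ * n : ℝ) : UnitAddCircle) := by
  have hθ0 : 0 < θ := by linarith
  have hn0 : (0 : ℝ) < n := by exact_mod_cast hn
  rw [_root_.charFun, Set.indicator_apply]
  refine if_congr ?_ rfl rfl
  have hiff (a : ℝ) : (θ * a - n) / θ = a - θ⁻¹ * n := by field_simp
  constructor
  · rintro ⟨a, -, ha⟩
    rw [Int.floor_eq_iff] at ha
    push_cast at ha
    refine ⟨a - θ⁻¹ * n, ⟨?_, ?_⟩, ?_⟩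
    · rw [← hiff]
      exact div_nonneg (by linarith) hθ0.le
    · rw [← hiff, inv_eq_one_div]
      gcongr
      linarith
    · rw [← sub_eq_zero, ← AddCircle.coe_sub, AddCircle.coe_eq_zero_iff]
      exact ⟨a, by simp⟩
  · rintro ⟨y, ⟨hy0, hy1⟩, hy⟩
    rw [← sub_eq_zero, ← AddCircle.coe_sub, AddCircle.coe_eq_zero_iff] at hy
    obtain ⟨m, hm⟩ := hy
    obtain rfl : y = m - θ⁻¹ * n := by
      simp at hm
      linarith
    rw [← hiff] at hy0 hy1
    rw [inv_eq_one_div, div_lt_div_iff_of_pos_right hθ0] at hy1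
    have hy0' : 0 ≤ θ * m - n := by
      by_contra! h
      exact absurd hy0 (not_le.2 (div_neg_of_neg_of_pos h hθ0))
    have hm0 : 0 < (m : ℝ) := by
      by_contra! h
      nlinarith
    lift m to ℕ using by exact_mod_cast hm0.le
    refine ⟨m, by exact_mod_cast hm0, ?_⟩
    rw [Int.floor_eq_iff]
    push_cast at *
    constructor <;> linarith

theorem isTrigPoly_finsupp_sum (c : ℤ →₀ ℂ) (δ : ℝ) :
    IsTrigPoly (fun n => c.sum (fun k a => a * e (k * δ * n))) := by
  refine ⟨c.support.card, fun ν => c (c.support.equivFin.symm ν),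
    fun ν => ((c.support.equivFin.symm ν : ℤ) : ℝ) * δ, fun n => ?_⟩
  rw [Equiv.sum_comp c.support.equivFin.symm
    (fun k : c.support => c k * e (((k : ℤ) : ℝ) * δ * n))]
  exact (Finset.sum_coe_sort c.support (fun k => c k * e ((k : ℝ) * δ * n))).symm

theorem seminorm2_le_sqrt {f : ℕ → ℂ} {ε : ℝ}
    (h : ∀ᶠ x : ℕ in atTop, (∑ n ∈ Icc 1 x, ‖f n‖ ^ 2) / x ≤ ε) : seminorm2 f ≤ √ε := by
  refine Real.sqrt_le_sqrt (limsup_le_of_le ?_ h)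
  exact isCoboundedUnder_le_of_le atTop (x := 0) fun x => by positivity

/-- Mean values of trigonometric polynomials vanish away from their frequencies. -/
theorem tendsto_mean_finsupp_sum (c : ℤ →₀ ℂ) {δ β : ℝ}
    (hβ : ∀ k m : ℤ, k * δ - β ≠ m) :
    Tendsto (fun x : ℕ => (∑ n ∈ Icc 1 x,
      c.sum (fun k a => a * e (k * δ * n)) * e (-(β * n))) / (x : ℂ)) atTop (nhds 0) := by
  have h : Tendsto (fun x : ℕ => ∑ k ∈ c.support,
      c k * ((∑ n ∈ Icc 1 x, e ((k * δ - β) * n)) / (x : ℂ))) atTop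
      (nhds (∑ k ∈ c.support, c k * 0)) :=
    tendsto_finsetSum _ fun k _ =>
      (tendsto_mean_e fun ⟨m, hm⟩ => hβ k m hm).const_mul (c k)
  simp only [mul_zero, Finset.sum_const_zero] at h
  refine h.congr fun x => ?_
  simp only [Finsupp.sum, Finset.sum_mul]
  rw [Finset.sum_comm, Finset.sum_div]
  refine Finset.sum_congr rfl fun k _ => ?_
  rw [← mul_div_assoc, Finset.mul_sum]
  congr 1
  refine Finset.sum_congr rfl fun n _ => ?_
  rw [mul_assoc, ← e_add]
  ring_nf

/-- A Fourier coefficient of a mean-square small function is small. -/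
theorem norm_mean_mul_e_sq_le (f : ℕ → ℂ) (β : ℝ) (x : ℕ) :
    ‖(∑ n ∈ Icc 1 x, f n * e (-(β * n))) / (x : ℂ)‖ ^ 2 ≤ (∑ n ∈ Icc 1 x, ‖f n‖ ^ 2) / x := by
  rcases Nat.eq_zero_or_pos x with rfl | hx
  · simp
  have hx0 : 0 < (x : ℝ) := by exact_mod_cast hx
  have h1 : ‖∑ n ∈ Icc 1 x, f n * e (-(β * n))‖ ≤ ∑ n ∈ Icc 1 x, ‖f n‖ :=
    norm_sum_le_of_le _ fun n _ => by rw [norm_mul, norm_e, mul_one]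
  have h2 := sq_sum_le_card_mul_sum_sq (s := Icc 1 x) (f := fun n => ‖f n‖)
  rw [Nat.card_Icc, Nat.add_sub_cancel] at h2
  rw [norm_div, Complex.norm_natCast, div_pow, div_le_div_iff₀ (by positivity) hx0]
  calc _ ≤ (x * ∑ n ∈ Icc 1 x, ‖f n‖ ^ 2) * (x : ℝ) := by
        gcongr
        exact (pow_le_pow_left₀ (norm_nonneg _) h1 2).trans h2
    _ = _ := by ring

theorem eq_zero_of_hasFourierCoeff {f : ℕ → ℂ} {δ β : ℝ} {z : ℂ}
    (hf : ∀ ε : ℝ, 0 < ε → ∃ c : ℤ →₀ ℂ, ∀ᶠ x : ℕ in atTop,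
      (∑ n ∈ Icc 1 x, ‖f n - c.sum (fun k a => a * e (k * δ * n))‖ ^ 2) / x ≤ ε)
    (hβ : ∀ k m : ℤ, k * δ - β ≠ m) (hz : HasFourierCoeff f β z) : z = 0 := by
  have hsq : ‖z‖ ^ 2 ≤ 0 := by
    refine le_of_forall_pos_le_add fun ε hε => ?_
    rw [zero_add]
    obtain ⟨c, hc⟩ := hf ε hε
    have hlim := ((Tendsto.sub hz (tendsto_mean_finsupp_sum c hβ)).norm.pow 2)
    rw [sub_zero] at hlim
    refine le_of_tendsto hlim ?_
    filter_upwards [hc] with x hx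
    rw [← sub_div, ← Finset.sum_sub_distrib]
    simp only [← sub_mul]
    exact (norm_mean_mul_e_sq_le _ β x).trans hx
  simpa using le_antisymm hsq (sq_nonneg _)

/-- for irrational `θ > 1`, the characteristic function of
`{k : ∃ a ≥ 1, ⌊θ·a⌋ = k}` is in `A²`, and its spectrum is contained in
`{k/θ mod 1 : k ∈ ℤ}` (modulo 1). -/
theorem stmt_15 (θ : ℝ) (hθ : 1 < θ) (hirr : Irrational θ) :
    MemA2 (charFun {k : ℕ | ∃ a : ℕ, 0 < a ∧ ⌊θ * (a : ℝ)⌋ = (k : ℤ)}) ∧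
    ∀ β ∈ spec (charFun {k : ℕ | ∃ a : ℕ, 0 < a ∧ ⌊θ * (a : ℝ)⌋ = (k : ℤ)}),
      ∃ k : ℤ, Int.fract β = Int.fract ((k : ℝ) / θ) := by
  set f := charFun {k : ℕ | ∃ a : ℕ, 0 < a ∧ ⌊θ * (a : ℝ)⌋ = (k : ℤ)} with hfdef
  have happrox : ∀ ε : ℝ, 0 < ε → ∃ c : ℤ →₀ ℂ, ∀ᶠ x : ℕ in atTop,
      (∑ n ∈ Icc 1 x, ‖f n - c.sum (fun k a => a * e (k * -θ⁻¹ * n))‖ ^ 2) / x ≤ ε := by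
    intro ε hε
    obtain ⟨c, hc⟩ := exists_trigPoly_approx_indicator hirr.inv.neg
      (haar_frontier_coe_image_Ico 0 θ⁻¹) hε
    refine ⟨c, hc.mono fun x hx => (Eq.le ?_).trans hx⟩
    congr 1
    refine Finset.sum_congr rfl fun n hn => ?_
    rw [hfdef, charFun_beatty_eq_indicator hθ (Finset.mem_Icc.1 hn).1]
  refine ⟨fun ε hε => ?_, ?_⟩
  · obtain ⟨c, hc⟩ := happrox ((ε / 2) ^ 2) (by positivity)
    refine ⟨_, isTrigPoly_finsupp_sum c (-θ⁻¹), (seminorm2_le_sqrt hc).trans_lt ?_⟩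
    rw [Real.sqrt_sq (by positivity)]
    linarith
  · rintro β ⟨z, hz0, hz⟩
    by_contra! hβ
    refine hz0 (eq_zero_of_hasFourierCoeff happrox (fun k m hkm => hβ (-k) ?_) hz)
    rw [Int.fract_eq_fract]
    refine ⟨-m, ?_⟩
    push_cast
    rw [← hkm, div_eq_mul_inv]
    ring
end
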